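/- Let α, β > -1, set ρ_α = α/2 + 1/4 and ρ_β = β/2 + 1/4, and for each n ≥ 1 let P_n^{(α,β),monic} be the monic Jacobi polynomial of degree n. If it is not the case that both 0 ≤ ρ_α ≤ 1/2 and 0 ≤ ρ_β ≤ 1/2 (equivalently, if α ∉ [-1/2,1/2] or β ∉ [-1/2,1/2]), then the sequence 2^{n-1+ρ_α+ρ_β} · sup_{x ∈ [-1,1]} (1-x)^{ρ_α} (1+x)^{ρ_β} |P_n^{(α,β),monic}(x)| does not converge to 1 as n → ∞. -/

import Mathlib

open MeasureTheory Filter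

/-- The weighted sup `sup_{x ∈ [-1,1]} (1-x)^ρα (1+x)^ρβ |P(x)|`. -/
noncomputable def jacobiSup (ρa ρb : ℝ) (P : Polynomial ℝ) : ℝ :=
  sSup ((fun x : ℝ => (1 - x) ^ ρa * (1 + x) ^ ρb * |P.eval x|) '' Set.Icc (-1 : ℝ) 1)

/-- `P` is the monic Jacobi polynomial of degree `n` with parameters `α, β`. -/
def IsMonicJacobi (α β : ℝ) (n : ℕ) (P : Polynomial ℝ) : Prop :=
  P.Monic ∧ P.natDegree = n ∧
    ∀ k : ℕ, k < n →
      ∫ x in (-1 : ℝ)..1, (1 - x) ^ α * (1 + x) ^ β * P.eval x * x ^ k = 0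

/-- A function on `(0, π)` whose derivative is `O(1 / sin²)` varies little away from the
endpoints. -/
theorem abs_sub_le_of_abs_deriv_le_div_sin_sq {f f' : ℝ → ℝ} {K θ₀ : ℝ} (hK : 0 ≤ K) (h0 : 0 < θ₀)
    (hθ : θ₀ < Real.pi / 2)
    (hf : ∀ θ ∈ Set.Ioo 0 Real.pi, HasDerivAt f (f' θ) θ)
    (hb : ∀ θ ∈ Set.Ioo 0 Real.pi, |f' θ| ≤ K / Real.sin θ ^ 2) :
    ∀ x ∈ Set.Icc θ₀ (Real.pi - θ₀), ∀ y ∈ Set.Icc θ₀ (Real.pi - θ₀),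
      |f x - f y| ≤ 2 * K / θ₀ := by
  have hsub : Set.Icc θ₀ (Real.pi - θ₀) ⊆ Set.Ioo 0 Real.pi := fun x hx =>
    ⟨lt_of_lt_of_le h0 hx.1, by linarith [hx.2]⟩
  have hcot : ∀ θ ∈ Set.Ioo 0 Real.pi,
      HasDerivAt (fun θ => Real.cos θ / Real.sin θ) (-(1 / Real.sin θ ^ 2)) θ := by
    intro θ hθ
    have hs := (Real.sin_pos_of_mem_Ioo hθ).ne'
    refine ((Real.hasDerivAt_cos θ).div (Real.hasDerivAt_sin θ) hs).congr_deriv ?_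
    rw [← neg_div]
    congr 1
    linarith [Real.sin_sq_add_cos_sq θ]
  have hmono : ∀ σ : ℝ, |σ| = 1 →
      MonotoneOn (fun θ => σ * f θ - K * (Real.cos θ / Real.sin θ)) (Set.Ioo 0 Real.pi) := by
    intro σ hσ
    have hd : ∀ θ ∈ Set.Ioo 0 Real.pi,
        HasDerivAt (fun θ => σ * f θ - K * (Real.cos θ / Real.sin θ))
          (σ * f' θ - K * (-(1 / Real.sin θ ^ 2))) θ := fun θ hθ =>
      ((hf θ hθ).const_mul σ).sub ((hcot θ hθ).const_mul K)
    refine monotoneOn_of_deriv_nonneg (convex_Ioo _ _)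
      (fun θ hθ => (hd θ hθ).continuousAt.continuousWithinAt)
      (fun θ hθ => (hd θ (interior_subset hθ)).differentiableAt.differentiableWithinAt) ?_
    intro θ hθ
    rw [interior_Ioo] at hθ
    rw [(hd θ hθ).deriv]
    have h1 : |σ * f' θ| ≤ K / Real.sin θ ^ 2 := by
      rw [abs_mul, hσ, one_mul]; exact hb θ hθ
    have h2 := (abs_le.1 h1).1
    have h3 : K * (-(1 / Real.sin θ ^ 2)) = -(K / Real.sin θ ^ 2) := by ring
    linarith
  have hbound : ∀ x ∈ Set.Icc θ₀ (Real.pi - θ₀), |Real.cos x / Real.sin x| ≤ 1 / θ₀ := by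
    have hanti : AntitoneOn (fun θ => Real.cos θ / Real.sin θ) (Set.Ioo 0 Real.pi) := by
      refine antitoneOn_of_deriv_nonpos (convex_Ioo _ _)
        (fun θ hθ => (hcot θ hθ).continuousAt.continuousWithinAt)
        (fun θ hθ => (hcot θ (interior_subset hθ)).differentiableAt.differentiableWithinAt) ?_
      intro θ hθ
      rw [interior_Ioo] at hθ
      rw [(hcot θ hθ).deriv]
      have := Real.sin_pos_of_mem_Ioo hθ
      simp only [Left.neg_nonpos_iff]
      positivity
    have hm0 : θ₀ ∈ Set.Icc θ₀ (Real.pi - θ₀) := ⟨le_rfl, by linarith⟩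
    have hm1 : Real.pi - θ₀ ∈ Set.Icc θ₀ (Real.pi - θ₀) := ⟨by linarith, le_rfl⟩
    have hs0 := Real.sin_pos_of_mem_Ioo (hsub hm0)
    have htan : Real.cos θ₀ / Real.sin θ₀ ≤ 1 / θ₀ := by
      have := Real.lt_tan h0 hθ
      rw [Real.tan_eq_sin_div_cos, lt_div_iff₀ (Real.cos_pos_of_mem_Ioo ⟨by linarith, hθ⟩)] at this
      rw [div_le_div_iff₀ hs0 h0]
      linarith
    intro x hx
    have h1 := hanti (hsub hm0) (hsub hx) hx.1
    have h2 := hanti (hsub hx) (hsub hm1) hx.2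
    simp only [Real.cos_pi_sub, Real.sin_pi_sub, neg_div] at h1 h2
    exact abs_le.2 ⟨by linarith, by linarith⟩
  have key : ∀ x ∈ Set.Icc θ₀ (Real.pi - θ₀), ∀ y ∈ Set.Icc θ₀ (Real.pi - θ₀), x ≤ y →
      |f x - f y| ≤ 2 * K / θ₀ := by
    intro x hx y hy hxy
    have h1 := hmono 1 (by simp) (hsub hx) (hsub hy) hxy
    have h2 := hmono (-1) (by simp) (hsub hx) (hsub hy) hxy
    have h3 := abs_le.1 (hbound x hx)
    have h4 := abs_le.1 (hbound y hy)
    simp only at h1 h2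
    have h5 : 2 * K / θ₀ = K * (1 / θ₀) + K * (1 / θ₀) := by ring
    have h6 := mul_le_mul_of_nonneg_left h3.1 hK
    have h7 := mul_le_mul_of_nonneg_left h3.2 hK
    have h8 := mul_le_mul_of_nonneg_left h4.1 hK
    have h9 := mul_le_mul_of_nonneg_left h4.2 hK
    rw [h5]
    exact abs_le.2 ⟨by linarith, by linarith⟩
  intro x hx y hy
  rcases le_total x y with h | h
  · exact key x hx y hy h
  · rw [abs_sub_comm]; exact key y hy x hx h

set_option maxHeartbeats 1000000 in
theorem amplitude_lower_bound {u : ℝ → ℝ} {X Y : ℝ → ℝ} {N θ₀ φ κ X₀ Y₀ : ℝ}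
    (hN : 0 < N) (h0 : 0 < θ₀) (hθ : θ₀ < Real.pi / 2) (hu : Continuous u)
    (hM : ∀ θ ∈ Set.Ioo 0 Real.pi, |u θ| ≤ 2)
    (hXY : ∀ θ, u θ = X θ * Real.cos (N * θ) + Y θ * Real.sin (N * θ))
    (hX : ∀ θ ∈ Set.Icc θ₀ (Real.pi - θ₀), |X θ - X₀| ≤ κ)
    (hY : ∀ θ ∈ Set.Icc θ₀ (Real.pi - θ₀), |Y θ - Y₀| ≤ κ)
    (hcoef : ∫ θ in (0 : ℝ)..Real.pi, u θ * Real.cos (N * θ - φ) = Real.pi / 2) :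
    1 - 2 * (4 * θ₀ + 2 / N + 4 * κ) ≤ X₀ ^ 2 + Y₀ ^ 2 := by
  have hκ : 0 ≤ κ := (abs_nonneg _).trans (hX θ₀ ⟨le_rfl, by linarith⟩)
  have hpi := Real.pi_gt_three
  have hpi4 := Real.pi_le_four
  by_cases hbig : 1 ≤ X₀ ^ 2 + Y₀ ^ 2
  · have : 0 ≤ 2 / N := by positivity
    linarith
  push Not at hbig
  have hX1 : |X₀| ≤ 1 := abs_le_one_iff_mul_self_le_one.2 (by nlinarith [sq_nonneg Y₀])
  have hY1 : |Y₀| ≤ 1 := abs_le_one_iff_mul_self_le_one.2 (by nlinarith [sq_nonneg X₀])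
  have hψc : Continuous fun θ => u θ * Real.cos (N * θ - φ) := by fun_prop
  have hψ : ∀ a b : ℝ, IntervalIntegrable (fun θ => u θ * Real.cos (N * θ - φ)) volume a b :=
    fun a b => hψc.intervalIntegrable a b
  have hend : ∀ a b : ℝ, a ≤ b → 0 ≤ a → b ≤ Real.pi →
      |∫ θ in a..b, u θ * Real.cos (N * θ - φ)| ≤ 2 * (b - a) := by
    intro a b hab ha hb
    have := intervalIntegral.norm_integral_le_of_norm_le_const_ae (a := a) (b := b) (C := 2)
      (f := fun θ => u θ * Real.cos (N * θ - φ)) ?_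
    · rwa [Real.norm_eq_abs, abs_of_nonneg (sub_nonneg.2 hab)] at this
    · have hne : ∀ᵐ θ : ℝ, θ ≠ Real.pi := by simp [ae_iff]
      filter_upwards [hne] with θ hne hθ
      rw [Set.uIoc_of_le hab] at hθ
      have h1 := hM θ ⟨by linarith [hθ.1], lt_of_le_of_ne (hθ.2.trans hb) hne⟩
      rw [Real.norm_eq_abs, abs_mul]
      have h2 := Real.abs_cos_le_one (N * θ - φ)
      nlinarith [abs_nonneg (u θ), abs_nonneg (Real.cos (N * θ - φ))]
  set L := X₀ * Real.cos φ + Y₀ * Real.sin φ with hL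
  set A := X₀ * Real.cos φ - Y₀ * Real.sin φ with hA
  set B := X₀ * Real.sin φ + Y₀ * Real.cos φ with hB
  have hcs : ∀ p q : ℝ, |p| ≤ 1 → |q| ≤ 1 → |p * q| ≤ 1 := by
    intro p q hp hq
    rw [abs_mul]; exact mul_le_one₀ hp (abs_nonneg _) hq
  have hc1 := abs_le.1 (hcs _ _ hX1 (Real.abs_cos_le_one φ))
  have hc2 := abs_le.1 (hcs _ _ hX1 (Real.abs_sin_le_one φ))
  have hc3 := abs_le.1 (hcs _ _ hY1 (Real.abs_cos_le_one φ))
  have hc4 := abs_le.1 (hcs _ _ hY1 (Real.abs_sin_le_one φ))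
  have hL2 : |L| ≤ 2 := abs_le.2 ⟨by linarith, by linarith⟩
  have hA2 : |A| ≤ 2 := abs_le.2 ⟨by linarith, by linarith⟩
  have hB2 : |B| ≤ 2 := abs_le.2 ⟨by linarith, by linarith⟩
  set m : ℝ → ℝ := fun θ =>
    (L * θ + (A * Real.sin (2 * N * θ) - B * Real.cos (2 * N * θ)) / (2 * N)) / 2 with hm
  set g : ℝ → ℝ := fun θ =>
    (X₀ * Real.cos (N * θ) + Y₀ * Real.sin (N * θ)) * Real.cos (N * θ - φ) with hg
  have hmd : ∀ θ, HasDerivAt m (g θ) θ := by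
    intro θ
    have hlin : HasDerivAt (fun θ : ℝ => 2 * N * θ) (2 * N) θ := by
      simpa using (hasDerivAt_id θ).const_mul (2 * N)
    have := (((hasDerivAt_id θ).const_mul L).add
      (((hlin.sin.const_mul A).sub (hlin.cos.const_mul B)).div_const (2 * N))).div_const 2
    refine this.congr_deriv ?_
    have e1 : 2 * N * θ = 2 * (N * θ) := by ring
    rw [hg]
    simp only [e1, Real.cos_two_mul, Real.sin_two_mul, Real.cos_sub]
    field_simp
    rw [hL, hA, hB]
    linear_combination (-2 * Y₀ * Real.sin φ) * Real.sin_sq_add_cos_sq (N * θ)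
  have hgc : Continuous g := by fun_prop
  have hgi : ∀ a b : ℝ, IntervalIntegrable g volume a b := fun a b => hgc.intervalIntegrable a b
  have hab : θ₀ ≤ Real.pi - θ₀ := by linarith
  have hmain : ∫ θ in θ₀..(Real.pi - θ₀), g θ = m (Real.pi - θ₀) - m θ₀ :=
    intervalIntegral.integral_eq_sub_of_hasDerivAt (fun θ _ => hmd θ) (hgi _ _)
  have hosc : ∀ θ, |(A * Real.sin (2 * N * θ) - B * Real.cos (2 * N * θ)) / (2 * N)| ≤ 2 / N := by
    intro θ
    rw [abs_div, abs_of_pos (by positivity : 0 < 2 * N), div_le_div_iff₀ (by positivity) hN]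
    have h1 : |A * Real.sin (2 * N * θ)| ≤ 2 := by
      rw [abs_mul]
      nlinarith [Real.abs_sin_le_one (2 * N * θ), abs_nonneg A, abs_nonneg (Real.sin (2 * N * θ))]
    have h2 : |B * Real.cos (2 * N * θ)| ≤ 2 := by
      rw [abs_mul]
      nlinarith [Real.abs_cos_le_one (2 * N * θ), abs_nonneg B, abs_nonneg (Real.cos (2 * N * θ))]
    have h3 := abs_sub (A * Real.sin (2 * N * θ)) (B * Real.cos (2 * N * θ))
    nlinarith
  have hdiff : |∫ θ in θ₀..(Real.pi - θ₀), (u θ * Real.cos (N * θ - φ) - g θ)| ≤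
      2 * κ * (Real.pi - θ₀ - θ₀) := by
    have := intervalIntegral.norm_integral_le_of_norm_le_const (a := θ₀) (b := Real.pi - θ₀)
      (C := 2 * κ) (f := fun θ => u θ * Real.cos (N * θ - φ) - g θ) ?_
    · rwa [Real.norm_eq_abs, abs_of_nonneg (sub_nonneg.2 hab)] at this
    · intro θ hθ
      rw [Set.uIoc_of_le hab] at hθ
      have h1 := hX θ ⟨hθ.1.le, hθ.2⟩
      have h2 := hY θ ⟨hθ.1.le, hθ.2⟩
      have e : u θ * Real.cos (N * θ - φ) - g θ = ((X θ - X₀) * Real.cos (N * θ) +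
          (Y θ - Y₀) * Real.sin (N * θ)) * Real.cos (N * θ - φ) := by
        rw [hXY, hg]; ring
      rw [e, Real.norm_eq_abs, abs_mul]
      have h3 : |(X θ - X₀) * Real.cos (N * θ)| ≤ κ := by
        rw [abs_mul]
        nlinarith [Real.abs_cos_le_one (N * θ), abs_nonneg (X θ - X₀),
          abs_nonneg (Real.cos (N * θ))]
      have h4 : |(Y θ - Y₀) * Real.sin (N * θ)| ≤ κ := by
        rw [abs_mul]
        nlinarith [Real.abs_sin_le_one (N * θ), abs_nonneg (Y θ - Y₀),
          abs_nonneg (Real.sin (N * θ))]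
      have h5 := abs_add_le ((X θ - X₀) * Real.cos (N * θ)) ((Y θ - Y₀) * Real.sin (N * θ))
      have h6 := Real.abs_cos_le_one (N * θ - φ)
      nlinarith [abs_nonneg (Real.cos (N * θ - φ)),
        abs_nonneg ((X θ - X₀) * Real.cos (N * θ) + (Y θ - Y₀) * Real.sin (N * θ))]
  rw [intervalIntegral.integral_sub (hψ _ _) (hgi _ _), hmain] at hdiff
  have hsplit1 := intervalIntegral.integral_add_adjacent_intervals (hψ 0 θ₀)
    (hψ θ₀ (Real.pi - θ₀))
  have hsplit2 := intervalIntegral.integral_add_adjacent_intervals (hψ 0 (Real.pi - θ₀))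
    (hψ (Real.pi - θ₀) Real.pi)
  have he1 := (abs_le.1 (hend 0 θ₀ h0.le le_rfl (by linarith))).2
  have he2 := (abs_le.1 (hend (Real.pi - θ₀) Real.pi (by linarith) (by linarith) le_rfl)).2
  have ho1 := (abs_le.1 (hosc (Real.pi - θ₀))).2
  have ho2 := (abs_le.1 (hosc θ₀)).1
  have hd := (abs_le.1 hdiff).2
  simp only [hm] at hd
  have hLθ : -(2 * θ₀) ≤ L * θ₀ := by
    have := mul_le_mul_of_nonneg_right (abs_le.1 hL2).1 h0.le
    linarith
  have hκθ : 2 * κ * (Real.pi - θ₀ - θ₀) ≤ 2 * κ * Real.pi :=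
    mul_le_mul_of_nonneg_left (by linarith) (by positivity)
  have hmainle : Real.pi / 2 ≤ L * Real.pi / 2 + 6 * θ₀ + 2 / N + 2 * κ * Real.pi := by
    generalize (A * Real.sin (2 * N * (Real.pi - θ₀)) - B * Real.cos (2 * N * (Real.pi - θ₀))) /
      (2 * N) = s₁ at hd ho1
    generalize (A * Real.sin (2 * N * θ₀) - B * Real.cos (2 * N * θ₀)) / (2 * N) = s₂ at hd ho2
    rw [mul_sub] at hd
    linarith
  have h2N : 0 ≤ 2 / N := by positivity
  have hLge : 1 - (4 * θ₀ + 2 / N + 4 * κ) ≤ L := by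
    by_contra hcon
    push Not at hcon
    have h1 := mul_lt_mul_of_pos_right hcon Real.pi_pos
    have h2 := mul_le_mul_of_nonneg_left hpi.le h0.le
    have h3 := mul_le_mul_of_nonneg_left hpi.le h2N
    generalize 2 / N = w at *
    nlinarith
  have hLsq : L ^ 2 ≤ X₀ ^ 2 + Y₀ ^ 2 := by
    have : X₀ ^ 2 + Y₀ ^ 2 - L ^ 2 = (X₀ * Real.sin φ - Y₀ * Real.cos φ) ^ 2 := by
      rw [hL]
      linear_combination -(X₀ ^ 2 + Y₀ ^ 2) * Real.sin_sq_add_cos_sq φ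
    nlinarith [sq_nonneg (X₀ * Real.sin φ - Y₀ * Real.cos φ)]
  nlinarith [sq_nonneg (L - 1)]

/-- The potential by which the Jacobi equation in `θ` differs from the harmonic oscillator. -/
noncomputable def jacobiPotential (a b θ : ℝ) : ℝ :=
  a / (2 * (1 - Real.cos θ)) + b / (2 * (1 + Real.cos θ))

theorem one_sub_cos_pos {θ : ℝ} (hθ : θ ∈ Set.Ioo 0 Real.pi) : 0 < 1 - Real.cos θ := by
  have := Real.sin_pos_of_mem_Ioo hθ
  nlinarith [Real.sin_sq_add_cos_sq θ, Real.cos_le_one θ, Real.neg_one_le_cos θ]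

theorem one_add_cos_pos {θ : ℝ} (hθ : θ ∈ Set.Ioo 0 Real.pi) : 0 < 1 + Real.cos θ := by
  have := Real.sin_pos_of_mem_Ioo hθ
  nlinarith [Real.sin_sq_add_cos_sq θ, Real.cos_le_one θ, Real.neg_one_le_cos θ]

theorem abs_jacobiPotential_le (a b : ℝ) {θ : ℝ} (hθ : θ ∈ Set.Ioo 0 Real.pi) :
    |jacobiPotential a b θ| ≤ (|a| + |b|) / Real.sin θ ^ 2 := by
  have h1 := one_sub_cos_pos hθ
  have h2 := one_add_cos_pos hθ
  have h3 : Real.sin θ ^ 2 = (1 - Real.cos θ) * (1 + Real.cos θ) := by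
    linarith [Real.sin_sq_add_cos_sq θ]
  have e1 : a / (2 * (1 - Real.cos θ)) =
      a * ((1 + Real.cos θ) / 2) / ((1 - Real.cos θ) * (1 + Real.cos θ)) := by
    field_simp
  have e2 : b / (2 * (1 + Real.cos θ)) =
      b * ((1 - Real.cos θ) / 2) / ((1 - Real.cos θ) * (1 + Real.cos θ)) := by
    field_simp
  rw [jacobiPotential, h3, e1, e2, ← add_div, abs_div, abs_of_pos (mul_pos h1 h2)]
  gcongr
  refine (abs_add_le _ _).trans ?_
  rw [abs_mul, abs_mul, abs_of_pos (half_pos h1), abs_of_pos (half_pos h2)]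
  have := abs_nonneg a
  have := abs_nonneg b
  nlinarith

theorem hasDerivAt_jacobiPotential (a b : ℝ) {θ : ℝ} (hθ : θ ∈ Set.Ioo 0 Real.pi) :
    HasDerivAt (jacobiPotential a b)
      (-(Real.sin θ / 2 * (a / (1 - Real.cos θ) ^ 2 - b / (1 + Real.cos θ) ^ 2))) θ := by
  have h1 := one_sub_cos_pos hθ
  have h2 := one_add_cos_pos hθ
  have d1 : HasDerivAt (fun θ => 2 * (1 - Real.cos θ)) (2 * Real.sin θ) θ := by
    simpa using ((Real.hasDerivAt_cos θ).const_sub 1).const_mul 2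
  have d2 : HasDerivAt (fun θ => 2 * (1 + Real.cos θ)) (2 * -Real.sin θ) θ :=
    ((Real.hasDerivAt_cos θ).const_add 1).const_mul 2
  refine (((hasDerivAt_const θ a).div d1 (by positivity)).add
    ((hasDerivAt_const θ b).div d2 (by positivity))).congr_deriv ?_
  field_simp
  ring

theorem jacobiPotential_nonneg {a b θ : ℝ} (ha : 0 < a) (h0 : 0 < θ)
    (hθ : θ ≤ a / (a + |b|)) : 0 ≤ jacobiPotential a b θ := by
  have hC : 0 < a + |b| := by positivity
  have hθ1 : θ ≤ 1 := hθ.trans ((div_le_one hC).2 (by linarith [abs_nonneg b]))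
  have hm : θ ∈ Set.Ioo 0 Real.pi := ⟨h0, by linarith [Real.pi_gt_three]⟩
  have h1 := one_sub_cos_pos hm
  have h2 := one_add_cos_pos hm
  have hc := Real.one_sub_sq_div_two_le_cos (x := θ)
  rw [le_div_iff₀ hC] at hθ
  have hc0 : 0 ≤ Real.cos θ := by nlinarith
  have hb : |b| * (1 - Real.cos θ) ≤ a / 2 := by
    have : |b| * θ ≤ a := by nlinarith
    nlinarith [abs_nonneg b]
  rw [jacobiPotential, div_add_div _ _ (by positivity) (by positivity)]
  apply div_nonneg _ (by positivity)
  have := neg_abs_le b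
  nlinarith

theorem deriv_jacobiPotential_le {a b θ : ℝ} (ha : 0 < a) (h0 : 0 < θ)
    (hθ : θ ≤ a / (a + |b|)) :
    a / (2 * θ ^ 3) ≤
      Real.sin θ / 2 * (a / (1 - Real.cos θ) ^ 2 - b / (1 + Real.cos θ) ^ 2) := by
  have hC : 0 < a + |b| := by positivity
  have hθ1 : θ ≤ 1 := hθ.trans ((div_le_one hC).2 (by linarith [abs_nonneg b]))
  have hm : θ ∈ Set.Ioo 0 Real.pi := ⟨h0, by linarith [Real.pi_gt_three]⟩
  have h1 := one_sub_cos_pos hm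
  have h2 := one_add_cos_pos hm
  have hc := Real.one_sub_sq_div_two_le_cos (x := θ)
  rw [le_div_iff₀ hC] at hθ
  have hc0 : 0 ≤ Real.cos θ := by nlinarith
  have hx1 : 1 - Real.cos θ ≤ θ ^ 2 / 2 := by linarith
  have hbθ : |b| * θ ≤ a := by nlinarith
  have hx2 : (1 - Real.cos θ) ^ 2 ≤ θ ^ 4 / 4 := by nlinarith
  have hθ4 : |b| * θ ^ 4 ≤ a := by
    have : θ ^ 3 ≤ 1 := pow_le_one₀ h0.le hθ1
    have : |b| * θ ^ 4 = (|b| * θ) * θ ^ 3 := by ring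
    have : 0 ≤ |b| * θ := by positivity
    nlinarith
  have hb : b / (1 + Real.cos θ) ^ 2 ≤ a / (2 * (1 - Real.cos θ) ^ 2) := by
    calc b / (1 + Real.cos θ) ^ 2 ≤ |b| / 1 := by
          gcongr
          · exact le_abs_self b
          · nlinarith
      _ ≤ a / (2 * (1 - Real.cos θ) ^ 2) := by
          rw [div_one, le_div_iff₀ (by positivity)]
          have : |b| * (1 - Real.cos θ) ^ 2 ≤ |b| * (θ ^ 4 / 4) := by gcongr
          linarith
  have hs : θ / 2 ≤ Real.sin θ := by
    have := Real.mul_le_sin h0.le (by linarith [Real.pi_gt_three])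
    have h4 : 1 / 2 ≤ 2 / Real.pi := by
      rw [div_le_div_iff₀ (by norm_num) Real.pi_pos]; linarith [Real.pi_le_four]
    nlinarith
  have hA : 2 * a / θ ^ 4 ≤ a / (1 - Real.cos θ) ^ 2 - b / (1 + Real.cos θ) ^ 2 := by
    have e : a / (1 - Real.cos θ) ^ 2 = 2 * (a / (2 * (1 - Real.cos θ) ^ 2)) := by
      field_simp
    have : 2 * a / θ ^ 4 ≤ a / (2 * (1 - Real.cos θ) ^ 2) := by
      rw [div_le_div_iff₀ (by positivity) (by positivity)]
      nlinarith
    linarith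
  calc a / (2 * θ ^ 3) = (θ / 2) / 2 * (2 * a / θ ^ 4) := by field_simp
    _ ≤ _ := by gcongr; linarith

/-- Solutions of `u'' + (N² - R) u = 0` are slowly modulated sinusoids away from the endpoints. -/
theorem exists_slow_amplitudes {a b N : ℝ} (hN : 0 < N) {u v : ℝ → ℝ}
    (hu : ∀ θ ∈ Set.Ioo 0 Real.pi, HasDerivAt u (v θ) θ)
    (hv : ∀ θ ∈ Set.Ioo 0 Real.pi,
      HasDerivAt v (-((N ^ 2 - jacobiPotential a b θ) * u θ)) θ)
    (hM : ∀ θ ∈ Set.Ioo 0 Real.pi, |u θ| ≤ 2) :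
    ∃ X Y : ℝ → ℝ,
      (∀ θ, u θ = X θ * Real.cos (N * θ) + Y θ * Real.sin (N * θ)) ∧
      (∀ θ, v θ / N = Y θ * Real.cos (N * θ) - X θ * Real.sin (N * θ)) ∧
      ∀ θ₀, 0 < θ₀ → θ₀ < Real.pi / 2 → ∀ x ∈ Set.Icc θ₀ (Real.pi - θ₀),
        ∀ y ∈ Set.Icc θ₀ (Real.pi - θ₀),
        |X x - X y| ≤ 4 * (|a| + |b|) / (N * θ₀) ∧ |Y x - Y y| ≤ 4 * (|a| + |b|) / (N * θ₀) := by
  have hlin : ∀ θ : ℝ, HasDerivAt (fun θ : ℝ => N * θ) N θ := fun θ => by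
    simpa using (hasDerivAt_id θ).const_mul N
  refine ⟨fun θ => u θ * Real.cos (N * θ) - v θ / N * Real.sin (N * θ),
    fun θ => u θ * Real.sin (N * θ) + v θ / N * Real.cos (N * θ), ?_, ?_, ?_⟩
  · intro θ
    linear_combination (-u θ) * Real.sin_sq_add_cos_sq (N * θ)
  · intro θ
    linear_combination (-(v θ / N)) * Real.sin_sq_add_cos_sq (N * θ)
  · intro θ₀ h0 hθ₀ x hx y hy
    have hX : ∀ θ ∈ Set.Ioo 0 Real.pi,
        HasDerivAt (fun θ => u θ * Real.cos (N * θ) - v θ / N * Real.sin (N * θ))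
          (-Real.sin (N * θ) * (jacobiPotential a b θ * u θ / N)) θ := by
      intro θ hθ
      refine (((hu θ hθ).mul (hlin θ).cos).sub
        (((hv θ hθ).div_const N).mul (hlin θ).sin)).congr_deriv ?_
      field_simp
      ring
    have hY : ∀ θ ∈ Set.Ioo 0 Real.pi,
        HasDerivAt (fun θ => u θ * Real.sin (N * θ) + v θ / N * Real.cos (N * θ))
          (Real.cos (N * θ) * (jacobiPotential a b θ * u θ / N)) θ := by
      intro θ hθ
      refine (((hu θ hθ).mul (hlin θ).sin).add
        (((hv θ hθ).div_const N).mul (hlin θ).cos)).congr_deriv ?_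
      field_simp
      ring
    have hbd : ∀ θ ∈ Set.Ioo 0 Real.pi, ∀ c : ℝ, |c| ≤ 1 →
        |c * (jacobiPotential a b θ * u θ / N)| ≤
          (2 * (|a| + |b|) / N) / Real.sin θ ^ 2 := by
      intro θ hθ c hc
      have h1 := abs_jacobiPotential_le a b hθ
      have h2 := hM θ hθ
      have e : (2 * (|a| + |b|) / N) / Real.sin θ ^ 2 =
          1 * ((|a| + |b|) / Real.sin θ ^ 2 * 2 / N) := by ring
      rw [abs_mul, abs_div, abs_mul, abs_of_pos hN, e]
      gcongr
    have hK : 0 ≤ 2 * (|a| + |b|) / N := by positivity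
    have e : 4 * (|a| + |b|) / (N * θ₀) = 2 * (2 * (|a| + |b|) / N) / θ₀ := by
      field_simp
      ring
    rw [e]
    exact ⟨abs_sub_le_of_abs_deriv_le_div_sin_sq hK h0 hθ₀ hX
        (fun θ hθ => hbd θ hθ _ (by rw [abs_neg]; exact Real.abs_sin_le_one _)) x hx y hy,
      abs_sub_le_of_abs_deriv_le_div_sin_sq hK h0 hθ₀ hY
        (fun θ hθ => hbd θ hθ _ (Real.abs_cos_le_one _)) x hx y hy⟩

/-- Any nonzero plane vector, read as amplitudes of a sinusoid, has a phase in each period. -/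
theorem exists_phase (X₀ Y₀ T : ℝ) :
    ∃ s ∈ Set.Ico T (T + 2 * Real.pi), ∀ x : ℝ,
      Y₀ * Real.cos (s + x) - X₀ * Real.sin (s + x) = √(X₀ ^ 2 + Y₀ ^ 2) * Real.cos x := by
  set z : ℂ := ⟨X₀, Y₀⟩ with hz
  have hnorm : ‖z‖ = √(X₀ ^ 2 + Y₀ ^ 2) := by
    rw [Complex.norm_def, Complex.normSq_apply]
    congr 1
    simp only [hz]; ring
  obtain ⟨k, hk, -⟩ := existsUnique_add_zsmul_mem_Ico Real.two_pi_pos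
    (z.arg - Real.pi / 2) T
  refine ⟨z.arg - Real.pi / 2 + k • (2 * Real.pi), hk, fun x => ?_⟩
  have e : z.arg - Real.pi / 2 + k • (2 * Real.pi) + x =
      (z.arg + x - Real.pi / 2) + k * (2 * Real.pi) := by
    rw [zsmul_eq_mul]; ring
  have hx : ‖z‖ * Real.cos z.arg = X₀ := Complex.norm_mul_cos_arg z
  have hy : ‖z‖ * Real.sin z.arg = Y₀ := Complex.norm_mul_sin_arg z
  rw [e, Real.cos_add_int_mul_two_pi, Real.sin_add_int_mul_two_pi, Real.cos_sub_pi_div_two,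
    Real.sin_sub_pi_div_two, ← hnorm, ← hx, ← hy, Real.cos_add, Real.sin_add]
  linear_combination (‖z‖ * Real.cos x) * Real.sin_sq_add_cos_sq z.arg

/-- The energy `u² + u'² / Q` of Sonin is nonincreasing where the potential decreases. -/
theorem hasDerivAt_soninEnergy {a b N : ℝ} {u v : ℝ → ℝ} {θ : ℝ} (hθ : θ ∈ Set.Ioo 0 Real.pi)
    (hu : HasDerivAt u (v θ) θ)
    (hv : HasDerivAt v (-((N ^ 2 - jacobiPotential a b θ) * u θ)) θ)
    (hQ : 0 < N ^ 2 - jacobiPotential a b θ) :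
    HasDerivAt (fun θ => u θ ^ 2 + v θ ^ 2 / (N ^ 2 - jacobiPotential a b θ))
      (-(Real.sin θ / 2 * (a / (1 - Real.cos θ) ^ 2 - b / (1 + Real.cos θ) ^ 2) * v θ ^ 2 /
        (N ^ 2 - jacobiPotential a b θ) ^ 2)) θ := by
  have hR := (hasDerivAt_jacobiPotential a b hθ).const_sub (N ^ 2)
  refine ((hu.pow 2).add ((hv.pow 2).div hR hQ.ne')).congr_deriv ?_
  generalize Real.sin θ / 2 * (a / (1 - Real.cos θ) ^ 2 - b / (1 + Real.cos θ) ^ 2) = w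
  have hQ' := hQ.ne'
  simp only [Pi.pow_apply]
  generalize N ^ 2 - jacobiPotential a b θ = q at hQ'
  push_cast
  field_simp
  ring

theorem jacobiPotential_lt_sq {a b N T θ : ℝ} (hN : 0 < N) (hT : |a| + |b| ≤ T) (hT8 : 8 ≤ T)
    (h1 : T / N ≤ θ) (h2 : θ ≤ 1) : jacobiPotential a b θ < N ^ 2 := by
  have h0 : 0 < θ := lt_of_lt_of_le (by positivity) h1
  have hm : θ ∈ Set.Ioo 0 Real.pi := ⟨h0, by linarith [Real.pi_gt_three]⟩
  have hs : θ / 2 ≤ Real.sin θ := by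
    have := Real.mul_le_sin h0.le (by linarith [Real.pi_gt_three])
    have h4 : 1 / 2 ≤ 2 / Real.pi := by
      rw [div_le_div_iff₀ (by norm_num) Real.pi_pos]; linarith [Real.pi_le_four]
    nlinarith
  have hTN : T ≤ N * θ := by rw [div_le_iff₀ hN] at h1; linarith
  refine lt_of_le_of_lt ((le_abs_self _).trans (abs_jacobiPotential_le a b hm)) ?_
  have hs0 : 0 < Real.sin θ := by linarith
  rw [div_lt_iff₀ (by positivity)]
  have h5 : (θ / 2) ^ 2 ≤ Real.sin θ ^ 2 := by gcongr
  have h6 : T ^ 2 ≤ (N * θ) ^ 2 := by gcongr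
  have h7 : N ^ 2 * (θ / 2) ^ 2 ≤ N ^ 2 * Real.sin θ ^ 2 := by gcongr
  nlinarith

set_option maxHeartbeats 1000000 in
/-- Solutions of the trigonometric Jacobi equation whose mean amplitude is at least one exceed one
by a fixed amount near an endpoint where the potential is repulsive. -/
theorem exists_sup_excess {a b : ℝ} (ha : 0 < a) (φ : ℝ) :
    ∃ ε > 0, ∃ N₀ > 0, ∀ N ≥ N₀, ∀ u v : ℝ → ℝ, Continuous u →
      (∀ θ ∈ Set.Ioo 0 Real.pi, HasDerivAt u (v θ) θ) →
      (∀ θ ∈ Set.Ioo 0 Real.pi,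
        HasDerivAt v (-((N ^ 2 - jacobiPotential a b θ) * u θ)) θ) →
      (∀ θ ∈ Set.Ioo 0 Real.pi, |u θ| ≤ 1 + ε) →
      ∫ θ in (0 : ℝ)..Real.pi, u θ * Real.cos (N * θ - φ) ≠ Real.pi / 2 := by
  set C : ℝ := |a| + |b| with hC
  have haC : a ≤ C := by rw [hC, abs_of_pos ha]; linarith [abs_nonneg b]
  have hC0 : 0 < C := ha.trans_le haC
  set T : ℝ := 32 * C + 8 with hT
  set T₂ : ℝ := T + 11 with hT₂
  have hT0 : 0 < T := by positivity
  have hT₂0 : 0 < T₂ := by positivity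
  set η : ℝ := min (a / (64 * T₂ ^ 3)) (1 / 2) with hη
  have hη0 : 0 < η := lt_min (by positivity) (by norm_num)
  have hη1 : η ≤ a / (64 * T₂ ^ 3) := min_le_left _ _
  have hη2 : η ≤ 1 / 2 := min_le_right _ _
  set T₃ : ℝ := max T₂ (128 * C / η) with hT₃
  have hT₃0 : 0 < T₃ := lt_max_of_lt_left hT₂0
  have hT₂₃ : T₂ ≤ T₃ := le_max_left _ _
  have hT₃C : 16 * C / T₃ ≤ η / 8 := by
    have : 128 * C / η ≤ T₃ := le_max_right _ _
    rw [div_le_iff₀ hη0] at this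
    rw [div_le_iff₀ hT₃0]; linarith
  set δ : ℝ := a / (a + |b|) with hδ
  have hδ0 : 0 < δ := by positivity
  have hδ1 : δ ≤ 1 := (div_le_one (by positivity)).2 (by linarith [abs_nonneg b])
  refine ⟨η / 12, by positivity, max (T₃ / δ) ((4 * T₃ + 2) * 8 / η), by positivity, ?_⟩
  intro N hN u v huc hu hv hM hcoef
  have hpi := Real.pi_gt_three
  have hpi4 := Real.pi_le_four
  have hN1 : T₃ / δ ≤ N := (le_max_left _ _).trans hN
  have hN2 : (4 * T₃ + 2) * 8 / η ≤ N := (le_max_right _ _).trans hN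
  have hN0 : 0 < N := lt_of_lt_of_le (by positivity) hN1
  have hNδ : T₃ / N ≤ δ := by
    rw [div_le_iff₀ hδ0] at hN1
    rw [div_le_iff₀ hN0]; linarith
  have hNη : (4 * T₃ + 2) / N ≤ η / 8 := by
    rw [div_le_iff₀ hη0] at hN2
    rw [div_le_iff₀ hN0]; linarith
  have hM2 : ∀ θ ∈ Set.Ioo 0 Real.pi, |u θ| ≤ 2 := fun θ hθ => (hM θ hθ).trans (by linarith)
  obtain ⟨X, Y, hXY, hXYv, hslow⟩ := exists_slow_amplitudes hN0 hu hv hM2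
  set θ₃ : ℝ := T₃ / N with hθ₃
  have hθ₃0 : 0 < θ₃ := by positivity
  have hθ₃1 : θ₃ ≤ 1 := hNδ.trans hδ1
  have hm₃ : θ₃ ∈ Set.Icc θ₃ (Real.pi - θ₃) := ⟨le_rfl, by linarith⟩
  have hNθ₃ : N * θ₃ = T₃ := by rw [hθ₃]; field_simp
  have hamp := amplitude_lower_bound (κ := 4 * C / T₃) (X₀ := X θ₃) (Y₀ := Y θ₃) hN0 hθ₃0
    (by linarith) huc hM2 hXY
    (fun θ hθ => by have := (hslow θ₃ hθ₃0 (by linarith) θ hθ θ₃ hm₃).1; rwa [hNθ₃] at this)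
    (fun θ hθ => by have := (hslow θ₃ hθ₃0 (by linarith) θ hθ θ₃ hm₃).2; rwa [hNθ₃] at this)
    hcoef
  have hamp' : 1 - η / 2 ≤ X θ₃ ^ 2 + Y θ₃ ^ 2 := by
    have e1 : 4 * θ₃ + 2 / N = (4 * T₃ + 2) / N := by rw [hθ₃]; ring
    have e2 : 4 * (4 * C / T₃) = 16 * C / T₃ := by ring
    rw [e1, e2] at hamp
    linarith
  -- the Sonin energy of `u`
  set E : ℝ → ℝ := fun θ => u θ ^ 2 + v θ ^ 2 / (N ^ 2 - jacobiPotential a b θ) with hE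
  have hT₃T : T ≤ T₃ := by linarith
  have hTC : |a| + |b| ≤ T := by rw [hT]; linarith
  have hI : ∀ θ ∈ Set.Icc (T / N) θ₃, θ ∈ Set.Ioo 0 Real.pi := fun θ hθ =>
    ⟨lt_of_lt_of_le (by positivity) hθ.1, by linarith [hθ.2]⟩
  have hQ : ∀ θ ∈ Set.Icc (T / N) θ₃, 0 < N ^ 2 - jacobiPotential a b θ := fun θ hθ =>
    sub_pos.2 (jacobiPotential_lt_sq hN0 hTC (by linarith) hθ.1 (hθ.2.trans hθ₃1))
  have hQN : ∀ θ ∈ Set.Icc (T / N) θ₃, N ^ 2 - jacobiPotential a b θ ≤ N ^ 2 := fun θ hθ => by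
    have := jacobiPotential_nonneg ha (hI θ hθ).1 (hθ.2.trans hNδ)
    linarith
  have hEd : ∀ θ ∈ Set.Icc (T / N) θ₃, HasDerivAt E _ θ := fun θ hθ =>
    hasDerivAt_soninEnergy (hI θ hθ) (hu θ (hI θ hθ)) (hv θ (hI θ hθ)) (hQ θ hθ)
  have hEle : ∀ θ ∈ Set.Icc (T / N) θ₃,
      deriv E θ ≤ -(a / (2 * θ ^ 3) * (v θ / N) ^ 2 / N ^ 2) := by
    intro θ hθ
    have h0 := (hI θ hθ).1
    have hq := hQ θ hθ
    rw [(hEd θ hθ).deriv, neg_le_neg_iff]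
    calc a / (2 * θ ^ 3) * (v θ / N) ^ 2 / N ^ 2
        = a / (2 * θ ^ 3) * v θ ^ 2 / (N ^ 2) ^ 2 := by field_simp
      _ ≤ _ := by
        have h1 := deriv_jacobiPotential_le ha h0 (hθ.2.trans hNδ)
        have h2 := hQN θ hθ
        have h3 : 0 ≤ a / (2 * θ ^ 3) := by positivity
        gcongr
        exact mul_nonneg (h3.trans h1) (sq_nonneg _)
  have hEc : ContinuousOn E (Set.Icc (T / N) θ₃) := fun θ hθ =>
    (hEd θ hθ).continuousAt.continuousWithinAt
  have hanti : AntitoneOn E (Set.Icc (T / N) θ₃) := by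
    refine antitoneOn_of_deriv_nonpos (convex_Icc _ _) hEc
      (fun θ hθ => (hEd θ (interior_subset hθ)).differentiableAt.differentiableWithinAt) ?_
    intro θ hθ
    have h0 := (hI θ (interior_subset hθ)).1
    refine (hEle θ (interior_subset hθ)).trans ?_
    rw [Left.neg_nonpos_iff]
    positivity
  have hE₃ : X θ₃ ^ 2 + Y θ₃ ^ 2 ≤ E θ₃ := by
    have hm : θ₃ ∈ Set.Icc (T / N) θ₃ := ⟨by rw [hθ₃]; gcongr, le_rfl⟩
    have h1 : v θ₃ ^ 2 / N ^ 2 ≤ v θ₃ ^ 2 / (N ^ 2 - jacobiPotential a b θ₃) :=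
      div_le_div_of_nonneg_left (sq_nonneg _) (hQ _ hm) (hQN _ hm)
    have h2 : X θ₃ ^ 2 + Y θ₃ ^ 2 = u θ₃ ^ 2 + v θ₃ ^ 2 / N ^ 2 := by
      rw [← div_pow, hXYv, hXY]
      linear_combination (-(X θ₃ ^ 2 + Y θ₃ ^ 2)) * Real.sin_sq_add_cos_sq (N * θ₃)
    simp only [hE]
    linarith
  -- a critical point, followed by a definite loss of energy
  obtain ⟨s, hs, hphase⟩ := exists_phase (X θ₃) (Y θ₃) T
  set r : ℝ := √(X θ₃ ^ 2 + Y θ₃ ^ 2) with hr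
  have hr34 : 3 / 4 ≤ r := Real.le_sqrt_of_sq_le (by linarith)
  have hmem : ∀ x, 0 ≤ x → x ≤ Real.pi + 1 / 2 → (s + x) / N ∈ Set.Icc (T / N) θ₃ := by
    intro x h0 hx
    have h1 := hs.1
    have h2 := hs.2
    have hpi' := Real.pi_lt_d2
    exact ⟨by gcongr; linarith, by rw [hθ₃]; gcongr; linarith⟩
  have hTN1 : T / N ≤ θ₃ := by rw [hθ₃]; gcongr
  have hvapprox : ∀ x, 0 ≤ x → x ≤ Real.pi + 1 / 2 →
      |v ((s + x) / N) / N - r * Real.cos x| ≤ 1 / 4 := by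
    intro x h0 hx
    have hθ := hmem x h0 hx
    have hTN0 : 0 < T / N := by positivity
    obtain ⟨h1, h2⟩ := hslow (T / N) hTN0 (by linarith) ((s + x) / N)
      ⟨hθ.1, by linarith [hθ.2]⟩ θ₃ ⟨hTN1, by linarith⟩
    have e1 : N * (T / N) = T := by field_simp
    have e2 : N * ((s + x) / N) = s + x := by field_simp
    have h3 : 4 * (|a| + |b|) / (N * (T / N)) ≤ 1 / 8 := by
      rw [e1, div_le_iff₀ hT0]; linarith
    rw [hXYv, e2, ← hphase x]
    have e3 : Y ((s + x) / N) * Real.cos (s + x) - X ((s + x) / N) * Real.sin (s + x) -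
        (Y θ₃ * Real.cos (s + x) - X θ₃ * Real.sin (s + x)) =
        (Y ((s + x) / N) - Y θ₃) * Real.cos (s + x) -
        (X ((s + x) / N) - X θ₃) * Real.sin (s + x) := by ring
    rw [e3]
    refine (abs_sub _ _).trans ?_
    rw [abs_mul, abs_mul]
    have h4 := mul_le_of_le_one_right (abs_nonneg (Y ((s + x) / N) - Y θ₃))
      (Real.abs_cos_le_one (s + x))
    have h5 := mul_le_of_le_one_right (abs_nonneg (X ((s + x) / N) - X θ₃))
      (Real.abs_sin_le_one (s + x))
    linarith
  have hvc : ContinuousOn v (Set.Icc (T / N) θ₃) := fun θ hθ =>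
    (hv θ (hI θ hθ)).continuousAt.continuousWithinAt
  obtain ⟨x₁, hx₁, hvx₁⟩ : ∃ x ∈ Set.Icc 0 Real.pi, v ((s + x) / N) / N = 0 := by
    have hcont : ContinuousOn (fun x => v ((s + x) / N) / N) (Set.Icc 0 Real.pi) := by
      refine ContinuousOn.div_const (hvc.comp (by fun_prop) ?_) N
      exact fun x hx => hmem x hx.1 (by linarith [hx.2])
    have h1 := abs_le.1 (hvapprox 0 le_rfl (by linarith))
    have h2 := abs_le.1 (hvapprox Real.pi (by linarith) (by linarith))
    rw [Real.cos_zero] at h1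
    rw [Real.cos_pi] at h2
    exact intermediate_value_Icc' Real.pi_pos.le hcont ⟨by linarith, by linarith⟩
  have hm₁ := hmem x₁ hx₁.1 (by linarith [hx₁.2])
  have hmp := hmem Real.pi (by linarith) (by linarith)
  have hmq := hmem (Real.pi + 1 / 2) (by linarith) le_rfl
  have hm₃' : θ₃ ∈ Set.Icc (T / N) θ₃ := ⟨hTN1, le_rfl⟩
  have hcrit : E ((s + x₁) / N) ≤ 1 + η / 4 := by
    have hv0 : v ((s + x₁) / N) = 0 := by
      rcases div_eq_zero_iff.1 hvx₁ with h | h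
      · exact h
      · exact absurd h hN0.ne'
    have hle := hM _ (hI _ hm₁)
    simp only [hE, hv0]
    rw [← sq_abs (u _)]
    have : |u ((s + x₁) / N)| ^ 2 ≤ (1 + η / 12) ^ 2 := by gcongr
    norm_num
    rw [← sq_abs (u _)]
    nlinarith
  have hstep1 : E ((s + Real.pi) / N) ≤ E ((s + x₁) / N) :=
    hanti hm₁ hmp (by gcongr; exact hx₁.2)
  have hstep3 : E θ₃ ≤ E ((s + (Real.pi + 1 / 2)) / N) := hanti hmq hm₃' hmq.2
  have hstep2 : E ((s + (Real.pi + 1 / 2)) / N) - E ((s + Real.pi) / N) ≤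
      -(a / (32 * T₂ ^ 3) * N) * ((s + (Real.pi + 1 / 2)) / N - (s + Real.pi) / N) := by
    have hsub : Set.Icc ((s + Real.pi) / N) ((s + (Real.pi + 1 / 2)) / N) ⊆
        Set.Icc (T / N) θ₃ := Set.Icc_subset_Icc hmp.1 hmq.2
    refine (convex_Icc ((s + Real.pi) / N) ((s + (Real.pi + 1 / 2)) /
      N)).image_sub_le_mul_sub_of_deriv_le
      (hEc.mono hsub)
      (fun θ hθ => (hEd θ (hsub (interior_subset hθ))).differentiableAt.differentiableWithinAt)
      ?_ _ (Set.left_mem_Icc.2 (by gcongr; linarith)) _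
      (Set.right_mem_Icc.2 (by gcongr; linarith)) (by gcongr; linarith)
    intro θ hθ
    have hθ' := interior_subset hθ
    refine (hEle θ (hsub hθ')).trans (neg_le_neg ?_)
    have h0 := (hI θ (hsub hθ')).1
    have hθN : θ = (s + (N * θ - s)) / N := by field_simp; ring
    have hl : Real.pi ≤ N * θ - s := by
      have := hθ'.1; rw [div_le_iff₀ hN0] at this; linarith
    have hrr : N * θ - s ≤ Real.pi + 1 / 2 := by
      have := hθ'.2; rw [le_div_iff₀ hN0] at this; linarith
    have happ := abs_le.1 (hvapprox _ (by linarith) hrr)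
    rw [← hθN] at happ
    have hcos : Real.cos (N * θ - s) ≤ -(7 / 8) := by
      have h1 := Real.one_sub_sq_div_two_le_cos (x := N * θ - s - Real.pi)
      rw [Real.cos_sub_pi] at h1
      nlinarith
    have hv1 : v θ / N ≤ -(1 / 4) := by nlinarith
    have hv2 : 1 / 16 ≤ (v θ / N) ^ 2 := by nlinarith
    have hθT : θ ≤ T₂ / N := by
      rw [le_div_iff₀ hN0]
      have := hs.2
      have hpi' := Real.pi_lt_d2
      linarith
    calc a / (32 * T₂ ^ 3) * N = a / (2 * (T₂ / N) ^ 3) * (1 / 16) / N ^ 2 := by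
          field_simp; norm_num
      _ ≤ _ := by gcongr
  have e : (s + (Real.pi + 1 / 2)) / N - (s + Real.pi) / N = 1 / (2 * N) := by
    field_simp; ring
  have e' : -(a / (32 * T₂ ^ 3) * N) * (1 / (2 * N)) = -(a / (64 * T₂ ^ 3)) := by
    field_simp; norm_num
  rw [e, e'] at hstep2
  linarith

theorem intervalIntegrable_one_sub_rpow_mul_one_add_rpow {α β : ℝ} (hα : -1 < α) (hβ : -1 < β) :
    IntervalIntegrable (fun x : ℝ => (1 - x) ^ α * (1 + x) ^ β) volume (-1) 1 := by
  have hplus : IntervalIntegrable (fun x : ℝ => (1 + x) ^ β) volume (-1) 0 := by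
    have := (intervalIntegral.intervalIntegrable_rpow' (a := 0) (b := 1) hβ).comp_add_left 1
    simpa using this
  have hminus : IntervalIntegrable (fun x : ℝ => (1 - x) ^ α) volume 0 1 := by
    have := (intervalIntegral.intervalIntegrable_rpow' (a := 0) (b := 1) hα).comp_sub_left 1
    simpa using this.symm
  refine IntervalIntegrable.trans (b := 0) ?_ ?_
  · refine hplus.continuousOn_mul (ContinuousOn.rpow_const (by fun_prop) fun x hx => Or.inl ?_)
    rw [Set.uIcc_of_le (by norm_num)] at hx
    linarith [hx.2]
  · refine hminus.mul_continuousOn (ContinuousOn.rpow_const (by fun_prop) fun x hx => Or.inl ?_)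
    rw [Set.uIcc_of_le (by norm_num)] at hx
    linarith [hx.1]

theorem intervalIntegrable_jacobiWeight_mul {α β : ℝ} (hα : -1 < α) (hβ : -1 < β)
    (q : Polynomial ℝ) :
    IntervalIntegrable (fun x : ℝ => (1 - x) ^ α * (1 + x) ^ β * q.eval x) volume (-1) 1 :=
  (intervalIntegrable_one_sub_rpow_mul_one_add_rpow hα hβ).mul_continuousOn
    q.continuous.continuousOn

theorem integral_jacobiWeight_mul_sq_pos {α β : ℝ} (hα : -1 < α) (hβ : -1 < β)
    {q : Polynomial ℝ} (hq : q ≠ 0) :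
    0 < ∫ x in (-1 : ℝ)..1, (1 - x) ^ α * (1 + x) ^ β * (q ^ 2).eval x := by
  have hw : ∀ x ∈ Set.Ioo (-1 : ℝ) 1, 0 < (1 - x) ^ α * (1 + x) ^ β := fun x hx =>
    mul_pos (Real.rpow_pos_of_pos (by linarith [hx.2]) _)
      (Real.rpow_pos_of_pos (by linarith [hx.1]) _)
  have hnn : ∀ x ∈ Set.Ioc (-1 : ℝ) 1, 0 ≤ (1 - x) ^ α * (1 + x) ^ β * (q ^ 2).eval x := by
    intro x hx
    rw [Polynomial.eval_pow]
    exact mul_nonneg (mul_nonneg (Real.rpow_nonneg (by linarith [hx.2]) _)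
      (Real.rpow_nonneg (by linarith [hx.1]) _)) (sq_nonneg _)
  rw [intervalIntegral.integral_pos_iff_support_of_nonneg_ae'
    ((ae_restrict_iff' (by measurability)).2 (Eventually.of_forall fun x hx => by
      rw [Set.uIoc_of_le (by norm_num)] at hx; exact hnn x hx))
    (intervalIntegrable_jacobiWeight_mul hα hβ _)]
  refine ⟨by norm_num, ?_⟩
  have hsub : Set.Ioo (-1 : ℝ) 1 \ q.rootSet ℝ ⊆
      Function.support (fun x : ℝ => (1 - x) ^ α * (1 + x) ^ β * (q ^ 2).eval x) ∩
        Set.Ioc (-1) 1 := by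
    rintro x ⟨hx, hr⟩
    refine ⟨?_, hx.1, hx.2.le⟩
    have : q.eval x ≠ 0 := fun h => hr ((Polynomial.mem_rootSet_of_ne hq).2 (by simpa using h))
    simp only [Function.mem_support, Polynomial.eval_pow]
    exact mul_ne_zero (hw x hx).ne' (pow_ne_zero _ this)
  refine lt_of_lt_of_le ?_ (measure_mono hsub)
  rw [measure_sdiff_null ((q.rootSet_finite ℝ).measure_zero _)]
  simp

theorem IsMonicJacobi.integral_mul_eq_zero {α β : ℝ} (hα : -1 < α) (hβ : -1 < β) {n : ℕ}
    {P : Polynomial ℝ} (hP : IsMonicJacobi α β n P) {q : Polynomial ℝ} (hq : q.degree < n) :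
    ∫ x in (-1 : ℝ)..1, (1 - x) ^ α * (1 + x) ^ β * (P * q).eval x = 0 := by
  by_cases h0 : q = 0
  · simp [h0]
  have e : ∀ x : ℝ, (1 - x) ^ α * (1 + x) ^ β * (P * q).eval x =
      ∑ k ∈ Finset.range n, q.coeff k * ((1 - x) ^ α * (1 + x) ^ β * (P * .X ^ k).eval x) := by
    intro x
    rw [Polynomial.eval_mul, Polynomial.eval_eq_sum_range' (n := n) (x := x)
      (p := q)]
    · simp only [Finset.mul_sum, Polynomial.eval_mul, Polynomial.eval_pow, Polynomial.eval_X]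
      exact Finset.sum_congr rfl fun k _ => by ring
    · exact (Polynomial.natDegree_lt_iff_degree_lt h0).2 hq
  simp only [e]
  rw [intervalIntegral.integral_finsetSum
    (fun k _ => (intervalIntegrable_jacobiWeight_mul hα hβ _).const_mul _)]
  refine Finset.sum_eq_zero fun k hk => ?_
  rw [intervalIntegral.integral_const_mul]
  have := hP.2.2 k (Finset.mem_range.1 hk)
  simp only [Polynomial.eval_mul, Polynomial.eval_pow, Polynomial.eval_X, ← mul_assoc] at this ⊢
  rw [this, mul_zero]

theorem IsMonicJacobi.eval_one_ne_zero {α β : ℝ} (hα : -1 < α) (hβ : -1 < β) {n : ℕ}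
    {P : Polynomial ℝ} (hP : IsMonicJacobi α β n P) : P.eval 1 ≠ 0 := by
  intro h
  obtain ⟨Q, rfl⟩ := Polynomial.dvd_iff_isRoot.2 h
  have hQ : Q ≠ 0 := by rintro rfl; simpa using hP.1.ne_zero
  have hdeg : Q.degree < n := by
    rw [← Polynomial.natDegree_lt_iff_degree_lt hQ, ← hP.2.1,
      Polynomial.natDegree_mul (Polynomial.X_sub_C_ne_zero _) hQ, Polynomial.natDegree_X_sub_C]
    omega
  have h0 := hP.integral_mul_eq_zero hα hβ hdeg
  have h1 := integral_jacobiWeight_mul_sq_pos (α := α + 1) (by linarith) hβ hQ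
  have e : ∫ x in (-1 : ℝ)..1, (1 - x) ^ (α + 1) * (1 + x) ^ β * (Q ^ 2).eval x =
      ∫ x in (-1 : ℝ)..1, -((1 - x) ^ α * (1 + x) ^ β *
        ((Polynomial.X - Polynomial.C 1) * Q * Q).eval x) := by
    refine intervalIntegral.integral_congr_ae ?_
    have hne : ∀ᵐ x : ℝ, x ≠ 1 := by simp [ae_iff]
    filter_upwards [hne] with x hne hx
    rw [Set.uIoc_of_le (by norm_num)] at hx
    have : 0 < 1 - x := sub_pos.2 (lt_of_le_of_ne hx.2 hne)
    rw [Real.rpow_add_one this.ne']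
    simp only [Polynomial.eval_mul, Polynomial.eval_pow, Polynomial.eval_sub, Polynomial.eval_X,
      Polynomial.eval_C]
    ring
  rw [e, intervalIntegral.integral_neg, h0] at h1
  simp at h1

/-- The Jacobi differential operator `(1 - x²) q'' + (β - α - (α + β + 2) x) q'`. -/
noncomputable def jacobiOperator (α β : ℝ) (q : Polynomial ℝ) : Polynomial ℝ :=
  (1 - .X ^ 2) * q.derivative.derivative +
    (.C (β - α) - .C (α + β + 2) * .X) * q.derivative

theorem integral_jacobiOperator_symm {α β : ℝ} (hα : -1 < α) (hβ : -1 < β)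
    (p q : Polynomial ℝ) :
    ∫ x in (-1 : ℝ)..1, (1 - x) ^ α * (1 + x) ^ β * (jacobiOperator α β p * q).eval x =
      ∫ x in (-1 : ℝ)..1, (1 - x) ^ α * (1 + x) ^ β * (p * jacobiOperator α β q).eval x := by
  rw [← sub_eq_zero, ← intervalIntegral.integral_sub
    (intervalIntegrable_jacobiWeight_mul hα hβ _) (intervalIntegrable_jacobiWeight_mul hα hβ _)]
  have hderiv : ∀ x ∈ Set.Ioo (-1 : ℝ) 1, HasDerivAt
      (fun x : ℝ => (1 - x) ^ (α + 1) * (1 + x) ^ (β + 1) *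
        (p.derivative * q - p * q.derivative).eval x)
      ((1 - x) ^ α * (1 + x) ^ β * (jacobiOperator α β p * q).eval x -
        (1 - x) ^ α * (1 + x) ^ β * (p * jacobiOperator α β q).eval x) x := by
    intro x hx
    have h1 : 0 < 1 - x := by linarith [hx.2]
    have h2 : 0 < 1 + x := by linarith [hx.1]
    have d1 := ((hasDerivAt_id x).const_sub 1).rpow_const (p := α + 1) (Or.inl h1.ne')
    have d2 := ((hasDerivAt_id x).const_add 1).rpow_const (p := β + 1) (Or.inl h2.ne')
    refine ((d1.mul d2).mul (Polynomial.hasDerivAt _ x)).congr_deriv ?_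
    simp only [id, add_sub_cancel_right, Real.rpow_add_one h1.ne', Real.rpow_add_one h2.ne',
      jacobiOperator, Polynomial.derivative_sub, Polynomial.derivative_mul, Polynomial.eval_add,
      Polynomial.eval_sub, Polynomial.eval_mul, Polynomial.eval_pow, Polynomial.eval_X,
      Polynomial.eval_C, Polynomial.eval_one, Pi.mul_apply]
    ring
  rw [intervalIntegral.integral_eq_sub_of_hasDerivAt_of_le (by norm_num) ?_ hderiv
    ((intervalIntegrable_jacobiWeight_mul hα hβ _).sub
      (intervalIntegrable_jacobiWeight_mul hα hβ _))]
  · simp [Real.zero_rpow (by linarith : α + 1 ≠ 0), Real.zero_rpow (by linarith : β + 1 ≠ 0)]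
  · refine Continuous.continuousOn ?_
    refine (Continuous.mul ?_ ?_).mul (Polynomial.continuous _)
    · exact Continuous.rpow_const (by fun_prop) fun x => Or.inr (by linarith)
    · exact Continuous.rpow_const (by fun_prop) fun x => Or.inr (by linarith)

theorem jacobiOperator_coeff (α β : ℝ) (q : Polynomial ℝ) (k : ℕ) :
    (jacobiOperator α β q).coeff k =
      q.coeff (k + 2) * (k + 2) * (k + 1) + (β - α) * (q.coeff (k + 1) * (k + 1)) -
        k * (k + α + β + 1) * q.coeff k := by
  have e : jacobiOperator α β q = q.derivative.derivative -
      .X ^ 2 * q.derivative.derivative +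
      .C (β - α) * q.derivative - .C (α + β + 2) * (.X * q.derivative) := by
    rw [jacobiOperator]; ring
  rw [e]
  simp only [Polynomial.coeff_sub, Polynomial.coeff_add, Polynomial.coeff_C_mul]
  rcases k with _ | _ | k
  · simp [Polynomial.coeff_derivative]
    left
    norm_num
  · simp [Polynomial.coeff_derivative, Polynomial.coeff_X_pow_mul', Polynomial.coeff_X_mul]
    ring
  · rw [Polynomial.coeff_X_pow_mul, Polynomial.coeff_X_mul]
    simp [Polynomial.coeff_derivative]
    ring

theorem jacobiOperator_degree_lt {α β : ℝ} {q : Polynomial ℝ} {n : ℕ} (hq : q.degree < n) :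
    (jacobiOperator α β q).degree < n := by
  rw [Polynomial.degree_lt_iff_coeff_zero] at hq ⊢
  intro k hk
  rw [jacobiOperator_coeff, hq k hk, hq (k + 1) (by omega), hq (k + 2) (by omega)]
  ring

theorem IsMonicJacobi.jacobiOperator_eq {α β : ℝ} (hα : -1 < α) (hβ : -1 < β) {n : ℕ}
    {P : Polynomial ℝ} (hP : IsMonicJacobi α β n P) :
    jacobiOperator α β P = -Polynomial.C (n * (n + α + β + 1) : ℝ) * P := by
  set S := jacobiOperator α β P + Polynomial.C (n * (n + α + β + 1) : ℝ) * P with hS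
  have hzero : ∀ k, n < k → P.coeff k = 0 := fun k hk =>
    Polynomial.coeff_eq_zero_of_natDegree_lt (by rw [hP.2.1]; exact hk)
  have hdeg : S.degree < n := by
    rw [Polynomial.degree_lt_iff_coeff_zero]
    intro k hk
    rw [hS, Polynomial.coeff_add, Polynomial.coeff_C_mul, jacobiOperator_coeff,
      hzero (k + 1) (by omega), hzero (k + 2) (by omega)]
    rcases hk.eq_or_lt with h | h
    · subst h; ring
    · rw [hzero k h]; ring
  suffices hS0 : S = 0 by
    rw [hS] at hS0
    rw [neg_mul]
    exact eq_neg_of_add_eq_zero_left hS0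
  by_contra hne
  have hpos := integral_jacobiWeight_mul_sq_pos hα hβ hne
  have e : ∀ x : ℝ, (1 - x) ^ α * (1 + x) ^ β * (S ^ 2).eval x =
      (1 - x) ^ α * (1 + x) ^ β * (jacobiOperator α β P * S).eval x +
        (n * (n + α + β + 1)) * ((1 - x) ^ α * (1 + x) ^ β * (P * S).eval x) := by
    intro x
    have : (S ^ 2).eval x = (jacobiOperator α β P * S).eval x +
        (n * (n + α + β + 1)) * (P * S).eval x := by
      have hSx : S.eval x = (jacobiOperator α β P).eval x +
          (n * (n + α + β + 1)) * P.eval x := by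
        rw [hS, Polynomial.eval_add, Polynomial.eval_mul, Polynomial.eval_C]
      simp only [Polynomial.eval_pow, Polynomial.eval_mul]
      linear_combination S.eval x * hSx
    rw [this]; ring
  simp only [e] at hpos
  rw [intervalIntegral.integral_add (intervalIntegrable_jacobiWeight_mul hα hβ _)
    ((intervalIntegrable_jacobiWeight_mul hα hβ _).const_mul _),
    intervalIntegral.integral_const_mul, integral_jacobiOperator_symm hα hβ,
    hP.integral_mul_eq_zero hα hβ hdeg,
    hP.integral_mul_eq_zero hα hβ (jacobiOperator_degree_lt hdeg)] at hpos
  simp at hpos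

/-- In the variable `x = cos θ`, the weighted Jacobi polynomial satisfies an equation without
first-order term. -/
theorem exists_deriv_weighted_jacobi {α β lam : ℝ} {P : Polynomial ℝ}
    (hP : jacobiOperator α β P = -Polynomial.C (lam * (lam + α + β + 1)) * P) (K : ℝ) :
    ∃ v : ℝ → ℝ, ∀ θ ∈ Set.Ioo 0 Real.pi,
      HasDerivAt (fun θ : ℝ => K * ((1 - Real.cos θ) ^ (α / 2 + 1 / 4) *
        (1 + Real.cos θ) ^ (β / 2 + 1 / 4) * P.eval (Real.cos θ))) (v θ) θ ∧
      HasDerivAt v (-(((lam + (α / 2 + 1 / 4) + (β / 2 + 1 / 4)) ^ 2 -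
        jacobiPotential (α ^ 2 - 1 / 4) (β ^ 2 - 1 / 4) θ) *
        (K * ((1 - Real.cos θ) ^ (α / 2 + 1 / 4) *
        (1 + Real.cos θ) ^ (β / 2 + 1 / 4) * P.eval (Real.cos θ))))) θ := by
  set A : ℝ := α / 2 + 1 / 4 with hA
  set B : ℝ := β / 2 + 1 / 4 with hB
  set W : ℝ → ℝ := fun θ => (1 - Real.cos θ) ^ A * (1 + Real.cos θ) ^ B with hW
  set l : ℝ → ℝ := fun θ => A * (Real.sin θ / (1 - Real.cos θ)) -
    B * (Real.sin θ / (1 + Real.cos θ)) with hl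
  have hWd : ∀ θ ∈ Set.Ioo 0 Real.pi, HasDerivAt W (W θ * l θ) θ := by
    intro θ hθ
    have h1 := one_sub_cos_pos hθ
    have h2 := one_add_cos_pos hθ
    have d1 := ((Real.hasDerivAt_cos θ).const_sub 1).rpow_const (p := A) (Or.inl h1.ne')
    have d2 := ((Real.hasDerivAt_cos θ).const_add 1).rpow_const (p := B) (Or.inl h2.ne')
    refine (d1.mul d2).congr_deriv ?_
    simp only [Real.rpow_sub_one h1.ne', Real.rpow_sub_one h2.ne', hW, hl]
    field_simp
    ring
  have hld : ∀ θ ∈ Set.Ioo 0 Real.pi,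
      HasDerivAt l (-(A / (1 - Real.cos θ)) - B / (1 + Real.cos θ)) θ := by
    intro θ hθ
    have h1 := one_sub_cos_pos hθ
    have h2 := one_add_cos_pos hθ
    refine ((((Real.hasDerivAt_sin θ).div ((Real.hasDerivAt_cos θ).const_sub 1) h1.ne').const_mul
      A).sub (((Real.hasDerivAt_sin θ).div ((Real.hasDerivAt_cos θ).const_add 1)
      h2.ne').const_mul B)).congr_deriv ?_
    have e1 : Real.cos θ * (1 - Real.cos θ) - Real.sin θ * - -Real.sin θ =
        -(1 - Real.cos θ) := by linarith [Real.sin_sq_add_cos_sq θ]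
    have e2 : Real.cos θ * (1 + Real.cos θ) - Real.sin θ * -Real.sin θ =
        1 + Real.cos θ := by linarith [Real.sin_sq_add_cos_sq θ]
    rw [e1, e2]
    field_simp
  refine ⟨fun θ => K * (W θ * (l θ * P.eval (Real.cos θ) +
    P.derivative.eval (Real.cos θ) * -Real.sin θ)), fun θ hθ => ?_⟩
  have h1 := one_sub_cos_pos hθ
  have h2 := one_add_cos_pos hθ
  have hPd : ∀ q : Polynomial ℝ, HasDerivAt (fun θ => q.eval (Real.cos θ))
      (q.derivative.eval (Real.cos θ) * -Real.sin θ) θ := fun q =>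
    (q.hasDerivAt _).comp θ (Real.hasDerivAt_cos θ)
  constructor
  · refine (((hWd θ hθ).mul (hPd P)).const_mul K).congr_deriv ?_
    ring
  · refine (((hWd θ hθ).mul (((hld θ hθ).mul (hPd P)).add ((hPd P.derivative).mul
      (Real.hasDerivAt_sin θ).neg))).const_mul K).congr_deriv ?_
    have hode := congrArg (Polynomial.eval (Real.cos θ)) hP
    simp only [jacobiOperator, Polynomial.eval_add, Polynomial.eval_sub, Polynomial.eval_mul,
      Polynomial.eval_pow, Polynomial.eval_X, Polynomial.eval_C, Polynomial.eval_one,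
      Polynomial.eval_neg] at hode
    have hs := Real.sin_sq_add_cos_sq θ
    change _ = -((_ - _) * (K * (W θ * _)))
    simp only [jacobiPotential, hl, Pi.add_apply, Pi.mul_apply, Pi.neg_apply]
    have hs2 : Real.sin θ * (Real.sin θ / (1 - Real.cos θ)) = 1 + Real.cos θ := by
      field_simp; linarith
    have hs3 : Real.sin θ * (Real.sin θ / (1 + Real.cos θ)) = 1 - Real.cos θ := by
      field_simp; linarith
    have hl2 : (A * (Real.sin θ / (1 - Real.cos θ)) - B * (Real.sin θ / (1 + Real.cos θ))) ^ 2 =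
        A ^ 2 * ((1 + Real.cos θ) / (1 - Real.cos θ)) +
        B ^ 2 * ((1 - Real.cos θ) / (1 + Real.cos θ)) - 2 * A * B := by
      have hs' : Real.sin θ ^ 2 = (1 - Real.cos θ) * (1 + Real.cos θ) := by linarith
      have : (A * (Real.sin θ / (1 - Real.cos θ)) - B * (Real.sin θ / (1 + Real.cos θ))) ^ 2 =
        Real.sin θ ^ 2 * (A / (1 - Real.cos θ) - B / (1 + Real.cos θ)) ^ 2 := by ring
      rw [this, hs']
      field_simp
      ring
    have hpot : A ^ 2 * ((1 + Real.cos θ) / (1 - Real.cos θ)) +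
        B ^ 2 * ((1 - Real.cos θ) / (1 + Real.cos θ)) - 2 * A * B +
        (-(A / (1 - Real.cos θ)) - B / (1 + Real.cos θ)) - lam * (lam + α + β + 1) =
        -((lam + A + B) ^ 2 - ((α ^ 2 - 1 / 4) / (2 * (1 - Real.cos θ)) +
          (β ^ 2 - 1 / 4) / (2 * (1 + Real.cos θ)))) := by
      rw [hA, hB]
      field_simp
      ring
    rw [← neg_mul, ← hpot, ← hl2]
    generalize P.eval (Real.cos θ) = p₀ at *
    generalize P.derivative.eval (Real.cos θ) = p₁ at *
    generalize P.derivative.derivative.eval (Real.cos θ) = p₂ at *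
    have hα : α = 2 * A - 1 / 2 := by rw [hA]; ring
    have hβ : β = 2 * B - 1 / 2 := by rw [hB]; ring
    generalize Real.sin θ / (1 - Real.cos θ) = t₁ at *
    generalize Real.sin θ / (1 + Real.cos θ) = t₂ at *
    clear_value A B W
    subst hα hβ
    linear_combination K * W θ * hode + K * W θ * p₂ * hs - 2 * K * W θ * p₁ * A * hs2 +
      2 * K * W θ * p₁ * B * hs3

theorem ofReal_mul_exp_cpow {r t : ℝ} (hr : 0 < r) (ht : t ∈ Set.Ioo (-Real.pi) Real.pi)
    (A : ℝ) : ((r : ℂ) * Complex.exp (t * Complex.I)) ^ ((2 * A : ℝ) : ℂ) =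
      (((r ^ 2) ^ A : ℝ) : ℂ) * Complex.exp ((2 * A * t : ℝ) * Complex.I) := by
  have hr' : (r : ℂ) ≠ 0 := by exact_mod_cast hr.ne'
  rw [Complex.cpow_def_of_ne_zero (mul_ne_zero hr' (Complex.exp_ne_zero _)),
    Complex.log_ofReal_mul hr (Complex.exp_ne_zero _), Complex.log_exp (by simpa using ht.1)
      (by simpa using ht.2.le), Real.rpow_def_of_pos (by positivity), Complex.ofReal_exp,
    ← Complex.exp_add, Real.log_pow]
  congr 1
  push_cast
  ring

/-- The polynomial `z ^ n * P ((z + z⁻¹) / 2)`. -/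
noncomputable def joukowskyLift (P : Polynomial ℝ) (z : ℂ) : ℂ :=
  ∑ k ∈ Finset.range (P.natDegree + 1),
    (P.coeff k : ℂ) / 2 ^ k * z ^ (P.natDegree - k) * (z ^ 2 + 1) ^ k

theorem joukowskyLift_zero (P : Polynomial ℝ) (hP : P.Monic) :
    joukowskyLift P 0 = ((2 ^ P.natDegree : ℝ) : ℂ)⁻¹ := by
  rw [joukowskyLift, Finset.sum_range_succ, Finset.sum_eq_zero]
  · simp [hP.coeff_natDegree]
  · intro k hk
    have : P.natDegree - k ≠ 0 := by have := Finset.mem_range.1 hk; omega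
    simp [this]

theorem joukowskyLift_exp (P : Polynomial ℝ) (θ : ℝ) :
    joukowskyLift P (Complex.exp (θ * Complex.I)) =
      (P.eval (Real.cos θ) : ℝ) * Complex.exp ((P.natDegree * θ : ℝ) * Complex.I) := by
  have hz : Complex.exp (θ * Complex.I) ^ 2 + 1 =
      2 * (Real.cos θ : ℂ) * Complex.exp (θ * Complex.I) := by
    rw [Complex.ofReal_cos, Complex.two_cos, add_mul, neg_mul, Complex.exp_neg,
      inv_mul_cancel₀ (Complex.exp_ne_zero _), sq]
  have hn : Complex.exp ((P.natDegree * θ : ℝ) * Complex.I) =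
      Complex.exp (θ * Complex.I) ^ P.natDegree := by
    rw [← Complex.exp_nat_mul]; push_cast; ring_nf
  rw [joukowskyLift, hn, hz, Polynomial.eval_eq_sum_range, Complex.ofReal_sum, Finset.sum_mul]
  refine Finset.sum_congr rfl fun k hk => ?_
  have hk' : k ≤ P.natDegree := by have := Finset.mem_range.1 hk; omega
  rw [← Nat.sub_add_cancel hk', pow_add, Nat.add_sub_cancel, mul_pow, mul_pow]
  push_cast
  field_simp

theorem continuous_joukowskyLift (P : Polynomial ℝ) : Continuous (joukowskyLift P) := by
  unfold joukowskyLift; fun_prop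

theorem differentiable_joukowskyLift (P : Polynomial ℝ) :
    Differentiable ℂ (joukowskyLift P) := by
  unfold joukowskyLift; fun_prop

theorem joukowskyLift_conj (P : Polynomial ℝ) (z : ℂ) :
    joukowskyLift P (starRingEnd ℂ z) = starRingEnd ℂ (joukowskyLift P z) := by
  simp [joukowskyLift, Complex.conj_ofNat]

theorem continuousAt_cpow_two_mul {A : ℝ} (hA : 0 ≤ A) {z : ℂ} (hz : 0 ≤ z.re) :
    ContinuousAt (fun z : ℂ => z ^ ((2 * A : ℝ) : ℂ)) z := by
  rcases hA.eq_or_lt with rfl | hA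
  · simpa using continuousAt_const
  · exact Complex.continuousAt_cpow_const_of_re_pos (Or.inl hz) (by
      rw [Complex.ofReal_re]; positivity)

theorem one_sub_exp_mul_I (θ : ℝ) : 1 - Complex.exp (θ * Complex.I) =
    ((2 * Real.sin (θ / 2) : ℝ) : ℂ) * Complex.exp (((θ - Real.pi) / 2 : ℝ) * Complex.I) := by
  have h1 : (θ - Real.pi) / 2 = θ / 2 - Real.pi / 2 := by ring
  have h2 : θ = 2 * (θ / 2) := by ring
  rw [Complex.exp_mul_I, Complex.exp_mul_I, ← Complex.ofReal_cos, ← Complex.ofReal_sin,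
    ← Complex.ofReal_cos, ← Complex.ofReal_sin, h1, Real.cos_sub_pi_div_two,
    Real.sin_sub_pi_div_two]
  nth_rw 1 [h2]
  nth_rw 2 [h2]
  rw [Real.cos_two_mul, Real.sin_two_mul]
  have := Real.sin_sq_add_cos_sq (θ / 2)
  rw [sq, sq] at this
  apply Complex.ext <;>
    simp [-Complex.ofReal_cos, -Complex.ofReal_sin, sq] <;> linarith

theorem one_add_exp_mul_I (θ : ℝ) : 1 + Complex.exp (θ * Complex.I) =
    ((2 * Real.cos (θ / 2) : ℝ) : ℂ) * Complex.exp ((θ / 2 : ℝ) * Complex.I) := by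
  have h2 : θ = 2 * (θ / 2) := by ring
  rw [Complex.exp_mul_I, Complex.exp_mul_I, ← Complex.ofReal_cos, ← Complex.ofReal_sin,
    ← Complex.ofReal_cos, ← Complex.ofReal_sin]
  nth_rw 1 [h2]
  nth_rw 2 [h2]
  rw [Real.cos_two_mul, Real.sin_two_mul]
  apply Complex.ext <;>
    simp [-Complex.ofReal_cos, -Complex.ofReal_sin, sq] <;> linarith

/-- The boundary function whose mean value yields the cosine coefficient of the weighted
polynomial. -/
noncomputable def weightedLift (A B : ℝ) (P : Polynomial ℝ) (z : ℂ) : ℂ :=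
  joukowskyLift P z * ((1 - z) ^ ((2 * A : ℝ) : ℂ) * (1 + z) ^ ((2 * B : ℝ) : ℂ))

theorem one_sub_re_nonneg {z : ℂ} (hz : ‖z‖ ≤ 1) : 0 ≤ (1 - z).re := by
  have := (Complex.re_le_norm z).trans hz
  simpa using this

theorem one_add_re_nonneg {z : ℂ} (hz : ‖z‖ ≤ 1) : 0 ≤ (1 + z).re := by
  have := one_sub_re_nonneg (z := -z) (by simpa using hz)
  simpa using this

theorem continuousAt_weightedLift {A B : ℝ} (hA : 0 ≤ A) (hB : 0 ≤ B) (P : Polynomial ℝ)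
    {z : ℂ} (hz : ‖z‖ ≤ 1) : ContinuousAt (weightedLift A B P) z := by
  refine (continuous_joukowskyLift P).continuousAt.mul (ContinuousAt.mul ?_ ?_)
  · exact ContinuousAt.comp (f := fun z : ℂ => 1 - z)
      (continuousAt_cpow_two_mul hA (one_sub_re_nonneg hz)) (by fun_prop)
  · exact ContinuousAt.comp (f := fun z : ℂ => 1 + z)
      (continuousAt_cpow_two_mul hB (one_add_re_nonneg hz)) (by fun_prop)

theorem weightedLift_conj (A B : ℝ) (P : Polynomial ℝ) {z : ℂ} (hz : ‖z‖ ≤ 1) :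
    weightedLift A B P (starRingEnd ℂ z) = starRingEnd ℂ (weightedLift A B P z) := by
  have key : ∀ (w : ℂ) (C : ℝ), 0 ≤ w.re →
      (starRingEnd ℂ w) ^ ((C : ℝ) : ℂ) = starRingEnd ℂ (w ^ ((C : ℝ) : ℂ)) := by
    intro w C hw
    rw [Complex.conj_cpow _ _ (fun h => ?_), Complex.conj_ofReal]
    rw [Complex.arg_eq_pi_iff] at h
    linarith [h.1]
  have h1 := key (1 - z) (2 * A) (one_sub_re_nonneg hz)
  have h2 := key (1 + z) (2 * B) (one_add_re_nonneg hz)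
  rw [map_sub, map_one] at h1
  rw [map_add, map_one] at h2
  rw [weightedLift, weightedLift, joukowskyLift_conj, h1, h2, map_mul, map_mul]

theorem weightedLift_exp_re (A B : ℝ) (P : Polynomial ℝ) {θ : ℝ} (hθ : θ ∈ Set.Ioo 0 Real.pi) :
    (weightedLift A B P (Complex.exp (θ * Complex.I))).re =
      2 ^ (A + B) * ((1 - Real.cos θ) ^ A * (1 + Real.cos θ) ^ B * P.eval (Real.cos θ) *
        Real.cos ((P.natDegree + A + B) * θ - Real.pi * A)) := by
  obtain ⟨h0, h1⟩ := hθ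
  have hs : 0 < 2 * Real.sin (θ / 2) :=
    mul_pos two_pos (Real.sin_pos_of_pos_of_lt_pi (by linarith) (by linarith))
  have hc : 0 < 2 * Real.cos (θ / 2) :=
    mul_pos two_pos (Real.cos_pos_of_mem_Ioo ⟨by linarith, by linarith⟩)
  have hs2 : (2 * Real.sin (θ / 2)) ^ 2 = 2 * (1 - Real.cos θ) := by
    rw [mul_pow, Real.sin_sq_eq_half_sub]; ring_nf
  have hc2 : (2 * Real.cos (θ / 2)) ^ 2 = 2 * (1 + Real.cos θ) := by
    rw [mul_pow, Real.cos_sq]; ring_nf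
  have p1 : 0 ≤ 1 - Real.cos θ := by linarith [Real.cos_le_one θ]
  have p2 : 0 ≤ 1 + Real.cos θ := by linarith [Real.neg_one_le_cos θ]
  rw [weightedLift, joukowskyLift_exp, one_sub_exp_mul_I, one_add_exp_mul_I,
    ofReal_mul_exp_cpow hs ⟨by linarith, by linarith⟩,
    ofReal_mul_exp_cpow hc ⟨by linarith, by linarith⟩, hs2, hc2,
    Real.mul_rpow two_pos.le p1, Real.mul_rpow two_pos.le p2, Real.rpow_add two_pos]
  have : ∀ (x y w : ℝ) (a b c : ℝ), (x : ℂ) * Complex.exp (a * Complex.I) *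
      (y * Complex.exp (b * Complex.I) * (w * Complex.exp (c * Complex.I))) =
      ((x * y * w : ℝ) : ℂ) * Complex.exp ((a + b + c : ℝ) * Complex.I) := by
    intro x y w a b c
    push_cast
    rw [add_mul, add_mul, Complex.exp_add, Complex.exp_add]
    ring
  rw [this, Complex.re_ofReal_mul, Complex.exp_ofReal_mul_I_re]
  have e : (P.natDegree : ℝ) * θ + 2 * A * ((θ - Real.pi) / 2) + 2 * B * (θ / 2) =
      (P.natDegree + A + B) * θ - Real.pi * A := by ring
  rw [e]
  ring

/-- The cosine coefficient of a weighted monic polynomial at the critical frequency depends only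
on the degree. -/
theorem integral_weighted_mul_cos {A B : ℝ} (hA : 0 ≤ A) (hB : 0 ≤ B) {P : Polynomial ℝ}
    (hP : P.Monic) :
    ∫ θ in (0 : ℝ)..Real.pi, (1 - Real.cos θ) ^ A * (1 + Real.cos θ) ^ B *
        P.eval (Real.cos θ) * Real.cos ((P.natDegree + A + B) * θ - Real.pi * A) =
      Real.pi * (2 ^ ((P.natDegree : ℝ) + A + B))⁻¹ := by
  set F : ℝ → ℂ := fun θ => weightedLift A B P (Complex.exp (θ * Complex.I)) with hF
  have hnorm : ∀ θ : ℝ, ‖Complex.exp (θ * Complex.I)‖ ≤ 1 := fun θ =>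
    (Complex.norm_exp_ofReal_mul_I θ).le
  have hFc : Continuous F := continuous_iff_continuousAt.2 fun θ =>
    ContinuousAt.comp (f := fun θ : ℝ => Complex.exp (θ * Complex.I))
      (continuousAt_weightedLift hA hB P (hnorm θ)) (by fun_prop)
  have hmean : ∫ θ in (0 : ℝ)..2 * Real.pi, F θ = 2 * Real.pi * ((2 ^ P.natDegree : ℝ) : ℂ)⁻¹ := by
    have h := circleAverage_of_differentiable_on_off_countable (f := weightedLift A B P) (c := 0)
      (R := 1) Set.countable_empty
      (fun z hz => (continuousAt_weightedLift hA hB P (by simpa using hz)).continuousWithinAt)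
      (fun z hz => by
        have hz' : ‖z‖ < 1 := by simpa using hz
        have m1 : 1 - z ∈ Complex.slitPlane := Or.inl (by
          have := (Complex.re_le_norm z).trans_lt hz'; simpa using this)
        have m2 : 1 + z ∈ Complex.slitPlane := Or.inl (by
          have := (Complex.re_le_norm (-z)).trans_lt (by simpa using hz')
          simp at this ⊢; linarith)
        refine (differentiable_joukowskyLift P z).mul (DifferentiableAt.mul ?_ ?_)
        · exact DifferentiableAt.cpow (by fun_prop) (by fun_prop) m1
        · exact DifferentiableAt.cpow (by fun_prop) (by fun_prop) m2)
    rw [Real.circleAverage_def] at h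
    simp only [circleMap, zero_add, Complex.ofReal_one, one_mul] at h
    have h0 : weightedLift A B P 0 = ((2 ^ P.natDegree : ℝ) : ℂ)⁻¹ := by
      rw [weightedLift, joukowskyLift_zero P hP]; simp
    rw [h0, inv_smul_eq_iff₀ (by positivity)] at h
    rw [hF, h, Complex.real_smul]
    push_cast
    ring
  have hre : ∀ a b : ℝ, ∫ θ in a..b, (F θ).re = (∫ θ in a..b, F θ).re := fun a b =>
    Complex.reCLM.intervalIntegral_comp_comm (hFc.intervalIntegrable a b)
  have hsymm : ∀ θ : ℝ, (F (2 * Real.pi - θ)).re = (F θ).re := by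
    intro θ
    have : Complex.exp ((2 * Real.pi - θ : ℝ) * Complex.I) =
        starRingEnd ℂ (Complex.exp (θ * Complex.I)) := by
      rw [← Complex.exp_conj, map_mul, Complex.conj_ofReal, Complex.conj_I]
      push_cast
      rw [sub_mul, Complex.exp_sub, Complex.exp_two_pi_mul_I, mul_neg, Complex.exp_neg, one_div]
    simp only [hF]
    rw [this, weightedLift_conj A B P (hnorm θ), Complex.conj_re]
  have hFr : Continuous fun θ => (F θ).re := Complex.continuous_re.comp hFc
  have hhalf : ∫ θ in (0 : ℝ)..Real.pi, (F θ).re = Real.pi * (2 ^ P.natDegree)⁻¹ := by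
    have h1 := intervalIntegral.integral_add_adjacent_intervals
      (hFr.intervalIntegrable (μ := volume) 0 Real.pi)
      (hFr.intervalIntegrable Real.pi (2 * Real.pi))
    have h2 := intervalIntegral.integral_comp_sub_left (a := 0) (b := Real.pi)
      (fun θ => (F θ).re) (2 * Real.pi)
    simp only [hsymm, sub_zero] at h2
    rw [show 2 * Real.pi - Real.pi = Real.pi by ring] at h2
    rw [← h2, hre 0 (2 * Real.pi), hmean] at h1
    have h3 : (2 * (Real.pi : ℂ) * ((2 ^ P.natDegree : ℝ) : ℂ)⁻¹).re =
        2 * Real.pi * (2 ^ P.natDegree)⁻¹ := by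
      rw [← Complex.ofReal_inv, ← Complex.ofReal_ofNat, ← Complex.ofReal_mul, ← Complex.ofReal_mul,
        Complex.ofReal_re]
    linarith
  have hcongr : ∫ θ in (0 : ℝ)..Real.pi, (F θ).re =
      ∫ θ in (0 : ℝ)..Real.pi, 2 ^ (A + B) * ((1 - Real.cos θ) ^ A * (1 + Real.cos θ) ^ B *
        P.eval (Real.cos θ) * Real.cos ((P.natDegree + A + B) * θ - Real.pi * A)) := by
    refine intervalIntegral.integral_congr_ae ?_
    filter_upwards [Measure.ae_ne volume Real.pi] with θ hθ hθ'
    rw [Set.uIoc_of_le Real.pi_pos.le] at hθ'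
    exact weightedLift_exp_re A B P ⟨hθ'.1, lt_of_le_of_ne hθ'.2 hθ⟩
  rw [hcongr, intervalIntegral.integral_const_mul] at hhalf
  have : (2 : ℝ) ^ (A + B) ≠ 0 := by positivity
  refine mul_left_cancel₀ this (hhalf.trans ?_)
  rw [add_assoc (P.natDegree : ℝ), Real.rpow_add two_pos (P.natDegree : ℝ), Real.rpow_natCast]
  field_simp

theorem jacobiSup_comp_neg (a b : ℝ) (P : Polynomial ℝ) (n : ℕ) :
    jacobiSup b a ((-1) ^ n * P.comp (-Polynomial.X)) = jacobiSup a b P := by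
  unfold jacobiSup
  congr 1
  have habs : ∀ x : ℝ, |((-1) ^ n * P.comp (-Polynomial.X)).eval x| = |P.eval (-x)| := by
    intro x
    simp [abs_mul, Polynomial.eval_comp]
  ext y
  constructor
  · rintro ⟨x, hx, rfl⟩
    refine ⟨-x, ⟨by linarith [hx.2], by linarith [hx.1]⟩, ?_⟩
    simp only [habs, sub_neg_eq_add, ← sub_eq_add_neg]
    ring
  · rintro ⟨x, hx, rfl⟩
    refine ⟨-x, ⟨by linarith [hx.2], by linarith [hx.1]⟩, ?_⟩
    simp only [habs, sub_neg_eq_add, ← sub_eq_add_neg, neg_neg]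
    ring

theorem IsMonicJacobi.comp_neg {α β : ℝ} {n : ℕ} {P : Polynomial ℝ} (hP : IsMonicJacobi α β n P) :
    IsMonicJacobi β α n ((-1) ^ n * P.comp (-Polynomial.X)) := by
  obtain ⟨hm, hn, ho⟩ := hP
  have hX : (-Polynomial.X : Polynomial ℝ).natDegree = 1 := by simp
  have hC : ((-1) ^ n : Polynomial ℝ) = Polynomial.C ((-1) ^ n) := by simp
  have hC0 : ((-1 : ℝ) ^ n) ≠ 0 := by positivity
  refine ⟨?_, ?_, fun k hk => ?_⟩
  · rw [Polynomial.Monic, hC, Polynomial.leadingCoeff_mul, Polynomial.leadingCoeff_C,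
      Polynomial.leadingCoeff_comp (by simp), hm.leadingCoeff, hn]
    simp [← mul_pow]
  · rw [hC, Polynomial.natDegree_C_mul hC0, Polynomial.natDegree_comp, hX, hn, mul_one]
  · have h := intervalIntegral.integral_comp_neg (a := (-1 : ℝ)) (b := 1)
      (fun x => (1 - x) ^ α * (1 + x) ^ β * P.eval x * x ^ k)
    rw [neg_neg, ho k hk] at h
    have h2 : ∀ x : ℝ, (1 - x) ^ β * (1 + x) ^ α *
        ((-1) ^ n * P.comp (-Polynomial.X)).eval x * x ^ k =
        ((-1) ^ n * (-1) ^ k) *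
          ((1 - -x) ^ α * (1 + -x) ^ β * P.eval (-x) * (-x) ^ k) := by
      intro x
      rw [neg_pow x k, sub_neg_eq_add, ← sub_eq_add_neg]
      have : ((-1 : ℝ) ^ k) * (-1) ^ k = 1 := by simp [← mul_pow]
      simp only [Polynomial.eval_mul, Polynomial.eval_pow, Polynomial.eval_neg,
        Polynomial.eval_one, Polynomial.eval_comp, Polynomial.eval_X]
      linear_combination (-(1 - x) ^ β * (1 + x) ^ α * ((-1) ^ n * P.eval (-x)) * x ^ k) * this
    simp only [h2]
    rw [intervalIntegral.integral_const_mul, h, mul_zero]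

/-- With a negative exponent the weighted polynomial is unbounded near the endpoint `1`. -/
theorem jacobiSup_eq_zero_of_neg {a b : ℝ} (ha : a < 0) {P : Polynomial ℝ} (hP : P.eval 1 ≠ 0) :
    jacobiSup a b P = 0 := by
  refine Real.sSup_of_not_bddAbove ?_
  have h0 : Tendsto (fun x : ℝ => 1 - x) (nhdsWithin 1 (Set.Iio 1)) (nhdsWithin 0 (Set.Ioi 0)) := by
    refine tendsto_nhdsWithin_iff.2 ⟨?_, ?_⟩
    · have : Tendsto (fun x : ℝ => 1 - x) (nhds 1) (nhds (1 - 1)) :=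
        (continuous_const.sub continuous_id).tendsto 1
      rw [sub_self] at this
      exact this.mono_left nhdsWithin_le_nhds
    · filter_upwards [self_mem_nhdsWithin] with x hx
      exact Set.mem_Ioi.2 (sub_pos.2 (Set.mem_Iio.1 hx))
  have h1 : Tendsto (fun x : ℝ => (1 - x) ^ a) (nhdsWithin 1 (Set.Iio 1)) atTop :=
    (tendsto_rpow_neg_nhdsGT_zero ha).comp h0
  have h2 : Tendsto (fun x : ℝ => (1 + x) ^ b * |P.eval x|) (nhdsWithin 1 (Set.Iio 1))
      (nhds ((1 + 1) ^ b * |P.eval 1|)) := by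
    have : ContinuousAt (fun x : ℝ => (1 + x) ^ b * |P.eval x|) 1 :=
      ((continuousAt_const.add continuousAt_id).rpow_const (Or.inl (by norm_num))).mul
        P.continuous.continuousAt.abs
    exact this.tendsto.mono_left nhdsWithin_le_nhds
  have h3 := h1.atTop_mul_pos (by positivity) h2
  rintro ⟨M, hM⟩
  have h4 : ∀ᶠ x : ℝ in nhdsWithin 1 (Set.Iio 1), x ∈ Set.Ioo (-1 : ℝ) 1 :=
    Ioo_mem_nhdsLT (by norm_num)
  obtain ⟨x, hx, hx'⟩ := ((h3.eventually_gt_atTop M).and h4).exists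
  refine absurd (hM ⟨x, ⟨hx'.1.le, hx'.2.le⟩, rfl⟩) (not_le.2 ?_)
  simpa only [mul_assoc] using hx

theorem weighted_abs_le_jacobiSup {a b : ℝ} (ha : 0 ≤ a) (hb : 0 ≤ b) (P : Polynomial ℝ) {x : ℝ}
    (hx : x ∈ Set.Icc (-1 : ℝ) 1) :
    (1 - x) ^ a * (1 + x) ^ b * |P.eval x| ≤ jacobiSup a b P := by
  refine le_csSup (isCompact_Icc.image ?_).bddAbove ⟨x, hx, rfl⟩
  exact (((continuous_const.sub continuous_id).rpow_const fun _ => Or.inr ha).mul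
    ((continuous_const.add continuous_id).rpow_const fun _ => Or.inr hb)).mul P.continuous.abs

theorem not_tendsto_jacobiSup_of_lt {α β : ℝ} (hα : -1 < α) (hβ : -1 < β) (h : α < -1 / 2)
    {P : ℕ → Polynomial ℝ} (hP : ∀ n : ℕ, 1 ≤ n → IsMonicJacobi α β n (P n)) :
    ¬ Tendsto (fun n : ℕ =>
        (2 : ℝ) ^ ((n : ℝ) - 1 + (α / 2 + 1 / 4) + (β / 2 + 1 / 4)) *
          jacobiSup (α / 2 + 1 / 4) (β / 2 + 1 / 4) (P n)) atTop (nhds 1) := by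
  intro ht
  refine zero_ne_one (tendsto_nhds_unique (tendsto_const_nhds.congr' ?_) ht)
  filter_upwards [eventually_ge_atTop 1] with n hn
  rw [jacobiSup_eq_zero_of_neg (by linarith) ((hP n hn).eval_one_ne_zero hα hβ), mul_zero]

theorem not_tendsto_jacobiSup_of_gt {α β : ℝ} (hα : 1 / 2 < α) (hβ : -1 / 2 ≤ β)
    {P : ℕ → Polynomial ℝ} (hP : ∀ n : ℕ, 1 ≤ n → IsMonicJacobi α β n (P n)) :
    ¬ Tendsto (fun n : ℕ =>
        (2 : ℝ) ^ ((n : ℝ) - 1 + (α / 2 + 1 / 4) + (β / 2 + 1 / 4)) *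
          jacobiSup (α / 2 + 1 / 4) (β / 2 + 1 / 4) (P n)) atTop (nhds 1) := by
  intro ht
  have ha : 0 < α ^ 2 - 1 / 4 := by nlinarith
  have hA : 0 ≤ α / 2 + 1 / 4 := by linarith
  have hB : 0 ≤ β / 2 + 1 / 4 := by linarith
  obtain ⟨ε, hε, N₀, -, hN₀⟩ := exists_sup_excess (b := β ^ 2 - 1 / 4) ha
    (Real.pi * (α / 2 + 1 / 4))
  obtain ⟨n, hnε, hn1, hnN⟩ := ((ht.eventually_le_const (by linarith : (1 : ℝ) < 1 + ε)).and
    ((eventually_ge_atTop 1).and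
      (tendsto_natCast_atTop_atTop.eventually_ge_atTop N₀))).exists
  obtain ⟨v, hv⟩ := exists_deriv_weighted_jacobi
    ((hP n hn1).jacobiOperator_eq (by linarith) (by linarith))
    ((2 : ℝ) ^ ((n : ℝ) - 1 + (α / 2 + 1 / 4) + (β / 2 + 1 / 4)))
  set A : ℝ := α / 2 + 1 / 4
  set B : ℝ := β / 2 + 1 / 4
  set K : ℝ := 2 ^ ((n : ℝ) - 1 + A + B) with hK
  refine hN₀ (n + A + B) (by linarith) _ v ?_ (fun θ hθ => (hv θ hθ).1)
    (fun θ hθ => (hv θ hθ).2) (fun θ _ => ?_) ?_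
  · exact continuous_const.mul ((((continuous_const.sub Real.continuous_cos).rpow_const
      fun _ => Or.inr hA).mul ((continuous_const.add Real.continuous_cos).rpow_const
      fun _ => Or.inr hB)).mul ((P n).continuous.comp Real.continuous_cos))
  · have h1 : 0 ≤ 1 - Real.cos θ := by linarith [Real.cos_le_one θ]
    have h2 : 0 ≤ 1 + Real.cos θ := by linarith [Real.neg_one_le_cos θ]
    rw [abs_mul, abs_mul, abs_of_nonneg (by positivity : 0 ≤ K), abs_of_nonneg (by positivity)]
    refine le_trans (mul_le_mul_of_nonneg_left ?_ (by positivity)) hnε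
    exact weighted_abs_le_jacobiSup hA hB (P n) ⟨Real.neg_one_le_cos θ, Real.cos_le_one θ⟩
  · have h := integral_weighted_mul_cos hA hB (hP n hn1).1
    rw [(hP n hn1).2.1] at h
    have h2 : (2 : ℝ) ^ ((n : ℝ) + A + B) = 2 * K := by
      rw [hK, show (n : ℝ) + A + B = ((n : ℝ) - 1 + A + B) + 1 by ring,
        Real.rpow_add_one two_ne_zero, mul_comm]
    simp only [mul_assoc K]
    rw [intervalIntegral.integral_const_mul, h, h2]
    have : K ≠ 0 := by positivity
    field_simp

theorem jacobi_weighted_sup_not_asymptotic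
    (α β : ℝ) (hα : -1 < α) (hβ : -1 < β)
    (h : ¬ (α ∈ Set.Icc (-(1 : ℝ) / 2) (1 / 2) ∧ β ∈ Set.Icc (-(1 : ℝ) / 2) (1 / 2)))
    (P : ℕ → Polynomial ℝ) (hP : ∀ n : ℕ, 1 ≤ n → IsMonicJacobi α β n (P n)) :
    ¬ Tendsto (fun n : ℕ =>
        (2 : ℝ) ^ ((n : ℝ) - 1 + (α / 2 + 1 / 4) + (β / 2 + 1 / 4)) *
          jacobiSup (α / 2 + 1 / 4) (β / 2 + 1 / 4) (P n))
      atTop (nhds 1) := by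
  have hP' : ∀ n : ℕ, 1 ≤ n → IsMonicJacobi β α n ((-1) ^ n * (P n).comp (-Polynomial.X)) :=
    fun n hn => (hP n hn).comp_neg
  have hswap : (fun n : ℕ => (2 : ℝ) ^ ((n : ℝ) - 1 + (α / 2 + 1 / 4) + (β / 2 + 1 / 4)) *
      jacobiSup (α / 2 + 1 / 4) (β / 2 + 1 / 4) (P n)) =
      fun n : ℕ => (2 : ℝ) ^ ((n : ℝ) - 1 + (β / 2 + 1 / 4) + (α / 2 + 1 / 4)) *
      jacobiSup (β / 2 + 1 / 4) (α / 2 + 1 / 4) ((-1) ^ n * (P n).comp (-Polynomial.X)) := by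
    funext n
    rw [jacobiSup_comp_neg, add_right_comm]
  rcases lt_or_ge α (-1 / 2) with h1 | h1
  · exact not_tendsto_jacobiSup_of_lt hα hβ h1 hP
  rcases lt_or_ge β (-1 / 2) with h2 | h2
  · rw [hswap]
    exact not_tendsto_jacobiSup_of_lt hβ hα h2 hP'
  rcases lt_or_ge (1 / 2) α with h3 | h3
  · exact not_tendsto_jacobiSup_of_gt h3 h2 hP
  rcases lt_or_ge (1 / 2) β with h4 | h4
  · rw [hswap]
    exact not_tendsto_jacobiSup_of_gt h4 h1 hP'
  exact absurd ⟨⟨h1, h3⟩, h2, h4⟩ h
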